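/- Let (M_t)_{t∈[0,T]} be a Borel measurable curve in P(P(ℝ^d)) satisfying the weighted integrability ∫_0^T∫∫[|a(t,x,μ)|/(1+|x|²) + |b(t,x,μ)|/(1+|x|)] dμ dM_t dt < ∞ and the weak equation ∂_t M_t = K*_{b_t,a_t}M_t. Then for every cylinder function F = Ψ∘L_Φ ∈ Cyl_c^{1,2}(P(ℝ^d)), the real function t ↦ ∫F(μ) dM_t(μ) belongs to W^{1,1}(0,T) with distributional derivative t ↦ ∫ Σ_i ∂_iΨ(L_Φ(μ)) ∫ L_{b,a}φ_i(t,x,μ) dμ(x) dM_t(μ), and there exists a curve (M̃_t) absolutely continuous with respect to the Wasserstein distance W_{1,D_{2,w}} on P(P(ℝ^d)) with M̃_t = M_t for a.e. t. -/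

import Mathlib

open MeasureTheory Set
open scoped ENNReal RealInnerProductSpace

noncomputable section

abbrev Ed (d : ℕ) := EuclideanSpace ℝ (Fin d)

abbrev Pm (d : ℕ) := ProbabilityMeasure (Ed d)

instance (d : ℕ) : MeasurableSpace (Pm d) := borel _

def IsTestXi (T : ℝ) (ξ : ℝ → ℝ) : Prop :=
  ContDiff ℝ 1 ξ ∧ HasCompactSupport ξ ∧ Function.support ξ ⊆ Set.Ioo 0 T

def IsTestPhi {d : ℕ} (φ : Ed d → ℝ) : Prop :=
  ContDiff ℝ 2 φ ∧ HasCompactSupport φ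

/-- `L_{b,a}φ(t,x,μ)`. -/
def Lop {d : ℕ} (b : ℝ → Ed d → Pm d → Ed d)
    (a : ℝ → Ed d → Pm d → (Ed d →L[ℝ] Ed d))
    (μ : Pm d) (t : ℝ) (φ : Ed d → ℝ) (x : Ed d) : ℝ :=
  ⟪b t x μ, gradient φ x⟫ +
    (1/2) * LinearMap.trace ℝ (Ed d) ((a t x μ ∘L fderiv ℝ (gradient φ) x).toLinearMap)

def LPhi {d k : ℕ} (Φ : Fin k → Ed d → ℝ) (μ : Pm d) : Fin k → ℝ :=
  fun i => ∫ x, Φ i x ∂(μ : Measure (Ed d))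

def wInt {d : ℕ} (b : ℝ → Ed d → Pm d → Ed d)
    (a : ℝ → Ed d → Pm d → (Ed d →L[ℝ] Ed d)) (t : ℝ) (x : Ed d) (μ : Pm d) : ℝ :=
  ‖b t x μ‖ / (1 + ‖x‖) + ‖a t x μ‖ / (1 + ‖x‖ ^ 2)

/-- The weighted `C²` integral metric `D_{2,w}` on `P(ℝ^d)` (via `C_c²` test functions
with weighted norm at most `1`). -/
noncomputable def D2w (d : ℕ) (μ ν : Measure (Ed d)) : ℝ :=
  sSup {r | ∃ φ : Ed d → ℝ, ContDiff ℝ 2 φ ∧ HasCompactSupport φ ∧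
    (∃ A B C : ℝ, A + B + C ≤ 1 ∧ (∀ x, |φ x| ≤ A) ∧
      (∀ x, (1 + ‖x‖) * ‖iteratedFDeriv ℝ 1 φ x‖ ≤ B) ∧
      (∀ x, (1 + ‖x‖ ^ 2) * ‖iteratedFDeriv ℝ 2 φ x‖ ≤ C)) ∧
    r = |∫ x, φ x ∂μ - ∫ x, φ x ∂ν|}

/-- The `1`-Wasserstein distance on `P(P(ℝ^d))` built over `D_{2,w}`. -/
noncomputable def WD2w (d : ℕ) (M N : Measure (Pm d)) : ℝ :=
  sInf {r | ∃ pl : Measure (Pm d × Pm d), IsProbabilityMeasure pl ∧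
    pl.map Prod.fst = M ∧ pl.map Prod.snd = N ∧
    r = ∫ p, D2w d (p.1 : Measure (Ed d)) (p.2 : Measure (Ed d)) ∂pl}

section Duality

variable {K : Type*} [TopologicalSpace K] [CompactSpace K] [MeasurableSpace K] [BorelSpace K]

/-- The Lipschitz envelope of `g` along the map `q`. -/
def lipEnvelope {E : Type*} [PseudoMetricSpace E] (q : K → E) (g : K → ℝ) (l : ℝ) (z : E) : ℝ :=
  ⨅ y, (g y + l * dist z (q y))

omit [MeasurableSpace K] [BorelSpace K] in
lemma bddBelow_lipEnvelope {E : Type*} [PseudoMetricSpace E] (q : K → E) (g : C(K, ℝ)) {l : ℝ}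
    (hl : 0 ≤ l) (z : E) : BddBelow (range fun y => g y + l * dist z (q y)) := by
  refine ⟨-‖g‖, ?_⟩
  rintro _ ⟨y, rfl⟩
  have h1 : -‖g‖ ≤ g y := (abs_le.1 (g.norm_coe_le_norm y)).1
  have h2 : 0 ≤ l * dist z (q y) := by positivity
  show -‖g‖ ≤ g y + l * dist z (q y)
  linarith

omit [MeasurableSpace K] [BorelSpace K] in
lemma lipschitzWith_lipEnvelope [Nonempty K] {E : Type*} [PseudoMetricSpace E] (q : K → E)
    (g : C(K, ℝ)) (l : NNReal) : LipschitzWith l (lipEnvelope q g l) := by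
  refine LipschitzWith.of_le_add_mul l fun z z' => ?_
  rw [← sub_le_iff_le_add]
  refine le_ciInf fun y => ?_
  have h1 : lipEnvelope q g l z ≤ g y + l * dist z (q y) :=
    ciInf_le (bddBelow_lipEnvelope q g l.2 z) y
  have h2 : (l : ℝ) * dist z (q y) ≤ l * (dist z z' + dist z' (q y)) :=
    mul_le_mul_of_nonneg_left (dist_triangle _ _ _) l.2
  linarith

lemma integrable_continuousMap {X : Type*} [TopologicalSpace X] [CompactSpace X]
    [MeasurableSpace X] [OpensMeasurableSpace X] (μ : Measure X) [IsFiniteMeasure μ]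
    {f : X → ℝ} (hf : Continuous f) : Integrable f μ := by
  obtain ⟨C, hC⟩ := (isCompact_range hf).isBounded.exists_norm_le
  exact Integrable.of_bound hf.measurable.aestronglyMeasurable C
    (Filter.Eventually.of_forall fun x => hC _ ⟨x, rfl⟩)

/-- The first `N` coordinates of a sequence of continuous functions. -/
def firstCoords (φ : ℕ → C(K, ℝ)) (N : ℕ) (x : K) : Fin N → ℝ := fun i => φ i x

omit [CompactSpace K] [MeasurableSpace K] [BorelSpace K] in
lemma continuous_firstCoords (φ : ℕ → C(K, ℝ)) (N : ℕ) : Continuous (firstCoords φ N) :=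
  continuous_pi fun i => (φ i).continuous

omit [TopologicalSpace K] [CompactSpace K] [BorelSpace K] in
lemma integral_sub_le_of_lipschitz (μ ν : Measure K) [IsProbabilityMeasure μ]
    [IsProbabilityMeasure ν] {N : ℕ} {q : K → Fin N → ℝ} {V : ℝ}
    (h : ∀ u : (Fin N → ℝ) → ℝ, LipschitzWith 1 u →
      ∫ x, u (q x) ∂μ - ∫ x, u (q x) ∂ν ≤ V) (l : NNReal) (u : (Fin N → ℝ) → ℝ)
    (hu : LipschitzWith l u) : ∫ x, u (q x) ∂μ - ∫ x, u (q x) ∂ν ≤ l * V := by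
  rcases eq_or_ne l 0 with rfl | hl
  · have : ∀ x, u x = u 0 := fun x => by
      have := hu.dist_le_mul x 0
      simpa using this
    simp [this]
  · have h1 : LipschitzWith 1 (fun z => (l : ℝ)⁻¹ * u z) := by
      refine LipschitzWith.of_dist_le_mul fun z z' => ?_
      have hl' : (0 : ℝ) < l := by positivity
      rw [Real.dist_eq, ← mul_sub, abs_mul, abs_of_pos (inv_pos.2 hl'), ← Real.dist_eq,
        inv_mul_le_iff₀ hl']
      simpa using hu.dist_le_mul z z'
    have h2 := h _ h1
    have hl' : (0 : ℝ) < l := by positivity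
    simp only [integral_const_mul] at h2
    rw [← mul_sub, inv_mul_le_iff₀ hl'] at h2
    exact h2

lemma nonneg_of_dual_constraint (μ ν : Measure K) [IsProbabilityMeasure μ]
    [IsProbabilityMeasure ν] (φ : ℕ → C(K, ℝ)) {V : ℝ}
    (h : ∀ N, ∀ u : (Fin N → ℝ) → ℝ, LipschitzWith 1 u →
      ∫ x, u (firstCoords φ N x) ∂μ - ∫ x, u (firstCoords φ N x) ∂ν ≤ V)
    (f g : C(K, ℝ)) (l : NNReal) (N : ℕ)
    (hfg : ∀ x y, 0 ≤ f x + g y + l * dist (firstCoords φ N x) (firstCoords φ N y)) :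
    0 ≤ ∫ x, f x ∂μ + ∫ x, g x ∂ν + l * V := by
  have : Nonempty K := μ.nonempty_of_neZero
  set q := firstCoords φ N
  have hq : Continuous q := continuous_firstCoords φ N
  set w := lipEnvelope q g l
  have hw : LipschitzWith l w := lipschitzWith_lipEnvelope q g l
  have hwq : Continuous fun x => w (q x) := hw.continuous.comp hq
  have h1 : ∀ y, w (q y) ≤ g y := fun y => by
    have h0 : w (q y) ≤ g y + l * dist (q y) (q y) :=
      ciInf_le (bddBelow_lipEnvelope q g l.2 (q y)) y
    simpa using h0
  have h2 : ∀ x, -w (q x) ≤ f x := fun x => by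
    have : -f x ≤ w (q x) := le_ciInf fun y => by have := hfg x y; linarith
    linarith
  have h3 : ∫ x, w (q x) ∂ν ≤ ∫ x, g x ∂ν :=
    integral_mono (integrable_continuousMap ν hwq) (integrable_continuousMap ν g.continuous) h1
  have h4 : ∫ x, -w (q x) ∂μ ≤ ∫ x, f x ∂μ :=
    integral_mono (integrable_continuousMap μ hwq.neg) (integrable_continuousMap μ f.continuous) h2
  have h5 : ∫ x, w (q x) ∂μ - ∫ x, w (q x) ∂ν ≤ l * V :=
    integral_sub_le_of_lipschitz μ ν (h N) l w hw
  rw [integral_neg] at h4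
  linarith

/-- The values of the dual problem attached to `h`. -/
def dualValues (μ ν : Measure K) (φ : ℕ → C(K, ℝ)) (V : ℝ) (h : C(K × K, ℝ)) : Set ℝ :=
  {r | ∃ (f g : C(K, ℝ)) (l : NNReal) (N : ℕ),
    (∀ x y, h (x, y) ≤ f x + g y + l * dist (firstCoords φ N x) (firstCoords φ N y)) ∧
    r = ∫ x, f x ∂μ + ∫ x, g x ∂ν + l * V}

lemma neg_norm_le_of_mem_dualValues (μ ν : Measure K) [IsProbabilityMeasure μ]
    [IsProbabilityMeasure ν] (φ : ℕ → C(K, ℝ)) {V : ℝ}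
    (hV : ∀ N, ∀ u : (Fin N → ℝ) → ℝ, LipschitzWith 1 u →
      ∫ x, u (firstCoords φ N x) ∂μ - ∫ x, u (firstCoords φ N x) ∂ν ≤ V)
    (h : C(K × K, ℝ)) {r : ℝ} (hr : r ∈ dualValues μ ν φ V h) : -‖h‖ ≤ r := by
  obtain ⟨f, g, l, N, hfg, rfl⟩ := hr
  have h1 := nonneg_of_dual_constraint μ ν φ hV (f + ContinuousMap.const K ‖h‖) g l N
    fun x y => by
      have h2 := (abs_le.1 (h.norm_coe_le_norm (x, y))).1
      have h3 := hfg x y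
      simp only [ContinuousMap.add_apply, ContinuousMap.const_apply]
      linarith
  simp only [ContinuousMap.add_apply, ContinuousMap.const_apply] at h1
  rw [integral_add (integrable_continuousMap μ f.continuous) (integrable_const _)] at h1
  simp only [integral_const, probReal_univ, one_smul] at h1
  linarith

omit [BorelSpace K] in
lemma norm_mem_dualValues (μ ν : Measure K) [IsProbabilityMeasure μ]
    (φ : ℕ → C(K, ℝ)) (V : ℝ) (h : C(K × K, ℝ)) : ‖h‖ ∈ dualValues μ ν φ V h := by
  refine ⟨ContinuousMap.const K ‖h‖, 0, 0, 0, fun x y => ?_, by simp⟩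
  simpa using (abs_le.1 (h.norm_coe_le_norm (x, y))).2

lemma add_mem_dualValues (μ ν : Measure K) [IsProbabilityMeasure μ] [IsProbabilityMeasure ν]
    (φ : ℕ → C(K, ℝ)) (V : ℝ) {h h' : C(K × K, ℝ)} {r r' : ℝ} (hr : r ∈ dualValues μ ν φ V h)
    (hr' : r' ∈ dualValues μ ν φ V h') : r + r' ∈ dualValues μ ν φ V (h + h') := by
  obtain ⟨f, g, l, N, hfg, rfl⟩ := hr
  obtain ⟨f', g', l', N', hfg', rfl⟩ := hr'
  refine ⟨f + f', g + g', l + l', max N N', fun x y => ?_, ?_⟩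
  · have hmono : ∀ {a b : ℕ}, a ≤ b → dist (firstCoords φ a x) (firstCoords φ a y)
        ≤ dist (firstCoords φ b x) (firstCoords φ b y) := fun {a b} hab =>
      (dist_pi_le_iff dist_nonneg).2 fun i =>
        dist_le_pi_dist (firstCoords φ b x) (firstCoords φ b y) (Fin.castLE hab i)
    have h1 := mul_le_mul_of_nonneg_left (hmono (le_max_left N N')) l.2
    have h2 := mul_le_mul_of_nonneg_left (hmono (le_max_right N N')) l'.2
    have h3 := hfg x y
    have h4 := hfg' x y
    simp only [ContinuousMap.add_apply, NNReal.coe_add, add_mul]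
    simp only [NNReal.val_eq_coe] at h1 h2
    linarith
  · simp only [ContinuousMap.add_apply, NNReal.coe_add]
    rw [integral_add (integrable_continuousMap μ f.continuous)
      (integrable_continuousMap μ f'.continuous),
      integral_add (integrable_continuousMap ν g.continuous)
      (integrable_continuousMap ν g'.continuous)]
    ring

omit [CompactSpace K] [BorelSpace K] in
lemma smul_mem_dualValues (μ ν : Measure K) (φ : ℕ → C(K, ℝ)) (V : ℝ) {h : C(K × K, ℝ)} {r : ℝ}
    (hr : r ∈ dualValues μ ν φ V h) {c : ℝ} (hc : 0 ≤ c) :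
    c * r ∈ dualValues μ ν φ V (c • h) := by
  obtain ⟨f, g, l, N, hfg, rfl⟩ := hr
  lift c to NNReal using hc
  refine ⟨(c : ℝ) • f, (c : ℝ) • g, c * l, N, fun x y => ?_, ?_⟩
  · have := mul_le_mul_of_nonneg_left (hfg x y) c.coe_nonneg
    simp only [ContinuousMap.smul_apply, smul_eq_mul, NNReal.coe_mul]
    linarith
  · simp only [ContinuousMap.smul_apply, smul_eq_mul, NNReal.coe_mul, integral_const_mul]
    ring

lemma exists_dual_functional (μ ν : Measure K) [IsProbabilityMeasure μ]
    [IsProbabilityMeasure ν] (φ : ℕ → C(K, ℝ)) {V : ℝ}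
    (hV : ∀ N, ∀ u : (Fin N → ℝ) → ℝ, LipschitzWith 1 u →
      ∫ x, u (firstCoords φ N x) ∂μ - ∫ x, u (firstCoords φ N x) ∂ν ≤ V) :
    ∃ Λ : C(K × K, ℝ) →ₗ[ℝ] ℝ, ∀ h, ∀ r ∈ dualValues μ ν φ V h, Λ h ≤ r := by
  have hbdd : ∀ h, BddBelow (dualValues μ ν φ V h) := fun h =>
    ⟨-‖h‖, fun r hr => neg_norm_le_of_mem_dualValues μ ν φ hV h hr⟩
  have hne : ∀ h, (dualValues μ ν φ V h).Nonempty := fun h =>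
    ⟨_, norm_mem_dualValues μ ν φ V h⟩
  set p : C(K × K, ℝ) → ℝ := fun h => sInf (dualValues μ ν φ V h) with hp
  have hsmul_le : ∀ c : ℝ, 0 < c → ∀ h, p (c • h) ≤ c * p h := fun c hc h => by
    rw [← div_le_iff₀' hc]
    refine le_csInf (hne h) fun r hr => ?_
    rw [div_le_iff₀' hc]
    exact csInf_le (hbdd _) (smul_mem_dualValues μ ν φ V hr hc.le)
  obtain ⟨Λ, -, hΛ⟩ := exists_extension_of_le_sublinear (⟨⊥, 0⟩ : C(K × K, ℝ) →ₗ.[ℝ] ℝ) p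
    (fun c hc h => le_antisymm (hsmul_le c hc h) (by
      have := hsmul_le c⁻¹ (inv_pos.2 hc) (c • h)
      rw [inv_smul_smul₀ hc.ne'] at this
      rwa [← le_inv_mul_iff₀ hc]))
    (fun h h' => by
      rw [← sub_le_iff_le_add]
      refine le_csInf (hne h) fun r hr => ?_
      rw [sub_le_comm]
      refine le_csInf (hne h') fun r' hr' => ?_
      rw [sub_le_iff_le_add']
      exact csInf_le (hbdd _) (add_mem_dualValues μ ν φ V hr hr'))
    (fun x => by
      have hx : (x : C(K × K, ℝ)) = 0 := (Submodule.mem_bot ℝ).1 x.2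
      rw [hx]
      refine le_csInf (hne 0) fun r hr => ?_
      simpa using neg_norm_le_of_mem_dualValues μ ν φ hV 0 hr)
  exact ⟨Λ, fun h r hr => (hΛ h).trans (csInf_le (hbdd h) hr)⟩

lemma exists_measure_of_positive_functional {X : Type*} [TopologicalSpace X] [CompactSpace X]
    [T2Space X] [MeasurableSpace X] [BorelSpace X] (Λ : C(X, ℝ) →ₗ[ℝ] ℝ)
    (hΛ : ∀ h : C(X, ℝ), (∀ x, 0 ≤ h x) → 0 ≤ Λ h) :
    ∃ π : Measure X, IsFiniteMeasure π ∧ ∀ h : C(X, ℝ), ∫ x, h x ∂π = Λ h := by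
  let e : CompactlySupportedContinuousMap X ℝ →ₗ[ℝ] C(X, ℝ) :=
    { toFun := fun f => f.toContinuousMap
      map_add' := fun _ _ => rfl
      map_smul' := fun _ _ => rfl }
  let Λ' : CompactlySupportedContinuousMap X ℝ →ₚ[ℝ] ℝ :=
    PositiveLinearMap.mk₀ (Λ.comp e) fun f hf => hΛ _ hf
  refine ⟨RealRMK.rieszMeasure Λ', inferInstance, fun h => ?_⟩
  exact RealRMK.integral_rieszMeasure Λ' ⟨h, HasCompactSupport.of_compactSpace _⟩

/-- **Kantorovich duality** for the increasing sequence of continuous pseudodistances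
`max_{i < N} |φ i x - φ i y|` on a compact metrizable space. -/
theorem exists_coupling_of_lipschitz_bound [TopologicalSpace.MetrizableSpace K]
    (μ ν : Measure K) [IsProbabilityMeasure μ]
    [IsProbabilityMeasure ν] (φ : ℕ → C(K, ℝ)) {V : ℝ}
    (hV : ∀ N, ∀ u : (Fin N → ℝ) → ℝ, LipschitzWith 1 u →
      ∫ x, u (firstCoords φ N x) ∂μ - ∫ x, u (firstCoords φ N x) ∂ν ≤ V) :
    ∃ π : Measure (K × K), IsProbabilityMeasure π ∧ π.map Prod.fst = μ ∧ π.map Prod.snd = ν ∧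
      ∀ N, ∫ p, dist (firstCoords φ N p.1) (firstCoords φ N p.2) ∂π ≤ V := by
  let := TopologicalSpace.metrizableSpaceMetric K
  have : SecondCountableTopology K := inferInstance
  obtain ⟨Λ, hΛ⟩ := exists_dual_functional μ ν φ hV
  obtain ⟨π, hπ, hint⟩ := exists_measure_of_positive_functional Λ fun h hh => by
    have h1 := hΛ (-h) 0 ⟨0, 0, 0, 0, fun x y => by simpa using hh (x, y), by simp⟩
    rw [map_neg] at h1
    linarith
  have hfst : ∀ f : C(K, ℝ), ∫ p, f p.1 ∂π = ∫ x, f x ∂μ := fun f => by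
    have key : ∀ f : C(K, ℝ), ∫ p, f p.1 ∂π ≤ ∫ x, f x ∂μ := fun f => by
      have h1 := hΛ (f.comp ContinuousMap.fst) (∫ x, f x ∂μ) ⟨f, 0, 0, 0, fun x y => by simp,
        by simp⟩
      rwa [← hint] at h1
    refine le_antisymm (key f) ?_
    have := key (-f)
    simp only [ContinuousMap.neg_apply, integral_neg] at this
    linarith
  have hsnd : ∀ f : C(K, ℝ), ∫ p, f p.2 ∂π = ∫ x, f x ∂ν := fun f => by
    have key : ∀ f : C(K, ℝ), ∫ p, f p.2 ∂π ≤ ∫ x, f x ∂ν := fun f => by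
      have h1 := hΛ (f.comp ContinuousMap.snd) (∫ x, f x ∂ν) ⟨0, f, 0, 0, fun x y => by simp,
        by simp⟩
      rwa [← hint] at h1
    refine le_antisymm (key f) ?_
    have := key (-f)
    simp only [ContinuousMap.neg_apply, integral_neg] at this
    linarith
  have hm1 : π.map Prod.fst = μ := by
    refine ext_of_forall_integral_eq_of_IsFiniteMeasure fun f => ?_
    rw [integral_map measurable_fst.aemeasurable f.continuous.aestronglyMeasurable]
    exact hfst f.toContinuousMap
  have hm2 : π.map Prod.snd = ν := by
    refine ext_of_forall_integral_eq_of_IsFiniteMeasure fun f => ?_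
    rw [integral_map measurable_snd.aemeasurable f.continuous.aestronglyMeasurable]
    exact hsnd f.toContinuousMap
  refine ⟨π, ⟨?_⟩, hm1, hm2, fun N => ?_⟩
  · rw [← preimage_univ (f := Prod.fst (α := K) (β := K)), ← Measure.map_apply measurable_fst
      MeasurableSet.univ, hm1, measure_univ]
  · have hq := continuous_firstCoords φ N
    have h1 := hΛ ⟨fun p => dist (firstCoords φ N p.1) (firstCoords φ N p.2), by fun_prop⟩ V
      ⟨0, 0, 1, N, fun x y => by simp, by simp⟩
    rwa [← hint] at h1

end Duality

section Mollification

open scoped Convolution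

lemma lipschitzWith_normed_convolution {E : Type*} [NormedAddCommGroup E] [NormedSpace ℝ E]
    [FiniteDimensional ℝ E] [MeasurableSpace E] [BorelSpace E] [HasContDiffBump E]
    (m : Measure E) [m.IsAddHaarMeasure] (ρ : ContDiffBump (0 : E)) {u : E → ℝ} {C : NNReal}
    (hu : LipschitzWith C u) :
    LipschitzWith C (ρ.normed m ⋆[ContinuousLinearMap.lsmul ℝ ℝ, m] u) := by
  refine LipschitzWith.of_dist_le_mul fun x y => ?_
  have hint : ∀ z, Integrable (fun t => ρ.normed m t • u (z - t)) m := fun z =>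
    (ρ.continuous_normed.smul (hu.continuous.comp (by fun_prop))).integrable_of_hasCompactSupport
      (ρ.hasCompactSupport_normed.smul_right)
  rw [Real.dist_eq]
  simp only [convolution, ContinuousLinearMap.lsmul_apply]
  rw [← integral_sub (hint x) (hint y), ← Real.norm_eq_abs]
  calc ‖∫ t, (ρ.normed m t • u (x - t) - ρ.normed m t • u (y - t)) ∂m‖
      ≤ ∫ t, ρ.normed m t * (C * dist x y) ∂m := by
        refine norm_integral_le_of_norm_le (ρ.integrable_normed.mul_const _)
          (Filter.Eventually.of_forall fun t => ?_)
        rw [← smul_sub, norm_smul, Real.norm_of_nonneg (ρ.nonneg_normed t)]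
        refine mul_le_mul_of_nonneg_left ?_ (ρ.nonneg_normed t)
        have := hu.dist_le_mul (x - t) (y - t)
        rwa [dist_sub_right, Real.dist_eq] at this
    _ = C * dist x y := by rw [integral_mul_const, ρ.integral_normed, one_mul]

lemma exists_lipschitz_truncation {E : Type*} [NormedAddCommGroup E] [NormedSpace ℝ E]
    [FiniteDimensional ℝ E] {u : E → ℝ} (hu : LipschitzWith 1 u) (r : ℝ) :
    ∃ v : E → ℝ, LipschitzWith 1 v ∧ HasCompactSupport v ∧ ∀ z, ‖z‖ ≤ r → v z = u z := by
  set R : ℝ := |u 0| + 2 * |r| with hR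
  set ρ : E → ℝ := fun z => max 0 (R - ‖z‖) with hρ
  have hρL : LipschitzWith 1 ρ := by
    have h1 : LipschitzWith 1 fun z : E => R - ‖z‖ := by
      simpa using (LipschitzWith.const R).sub (lipschitzWith_one_norm (E := E))
    simpa [hρ] using h1.const_max 0
  refine ⟨fun z => max (-ρ z) (min (u z) (ρ z)), ?_, ?_, fun z hz => ?_⟩
  · have := hρL.neg.max (hu.min hρL)
    simpa using this
  · refine HasCompactSupport.intro (isCompact_closedBall (0 : E) R) fun z hz => ?_
    have h0 : ρ z = 0 := by
      rw [mem_closedBall_zero_iff, not_le] at hz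
      exact max_eq_left (by linarith)
    simp [h0]
  · have h1 : |u z| ≤ |u 0| + ‖z‖ := by
      have h2 := hu.dist_le_mul z 0
      rw [Real.dist_eq, dist_zero_right, NNReal.coe_one, one_mul] at h2
      have := abs_sub_abs_le_abs_sub (u z) (u 0)
      linarith
    have h3 : |u z| ≤ ρ z := le_max_of_le_right (by
      have := le_abs_self r
      linarith)
    obtain ⟨h4, h5⟩ := abs_le.1 h3
    simp only [min_eq_left h5, max_eq_right h4]

/-- A `1`-Lipschitz function on a finite dimensional space is uniformly approximated on balls by
`1`-Lipschitz functions of class `C_c¹`. -/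
lemma exists_contDiff_lipschitz_approx {E : Type*} [NormedAddCommGroup E] [NormedSpace ℝ E]
    [FiniteDimensional ℝ E] {u : E → ℝ} (hu : LipschitzWith 1 u) (r : ℝ) {ε : ℝ} (hε : 0 < ε) :
    ∃ v : E → ℝ, ContDiff ℝ 1 v ∧ HasCompactSupport v ∧ LipschitzWith 1 v ∧
      ∀ z, ‖z‖ ≤ r → |v z - u z| ≤ ε := by
  obtain ⟨w, hw, hwc, hwu⟩ := exists_lipschitz_truncation hu r
  borelize E
  let m : Measure E := Measure.addHaar
  let ρ : ContDiffBump (0 : E) := ⟨ε / 2, ε, by positivity, by linarith⟩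
  refine ⟨ρ.normed m ⋆[ContinuousLinearMap.lsmul ℝ ℝ, m] w, ?_, ?_,
    lipschitzWith_normed_convolution m ρ hw, fun z hz => ?_⟩
  · exact ρ.hasCompactSupport_normed.contDiff_convolution_left _ (n := 1) ρ.contDiff_normed
      hw.continuous.locallyIntegrable
  · exact ρ.hasCompactSupport_normed.convolution _ hwc
  · rw [← hwu z hz, ← Real.dist_eq]
    refine ρ.dist_normed_convolution_le hw.continuous.aestronglyMeasurable fun x hx => ?_
    have h1 := hw.dist_le_mul x z
    rw [NNReal.coe_one, one_mul] at h1
    exact h1.trans (Metric.mem_ball.1 hx).le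

end Mollification

section DuBoisReymond

lemma exists_primitive_isTestXi {T : ℝ} {η : ℝ → ℝ} (hη : Continuous η)
    (hηc : HasCompactSupport η) (hηs : tsupport η ⊆ Ioo 0 T) (hη0 : ∫ t, η t = 0) :
    ∃ ξ, IsTestXi T ξ ∧ deriv ξ = η := by
  rcases (tsupport η).eq_empty_or_nonempty with he | hne
  · have : η = 0 := tsupport_eq_empty_iff.1 he
    refine ⟨0, ⟨contDiff_const, HasCompactSupport.zero, by simp⟩, ?_⟩
    rw [this]
    ext t
    simp
  obtain ⟨α, hα, hα'⟩ := hηc.isCompact.exists_isLeast hne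
  obtain ⟨β, hβ, hβ'⟩ := hηc.isCompact.exists_isGreatest hne
  have hz : ∀ t, t ∉ Icc α β → η t = 0 := fun t ht =>
    image_eq_zero_of_notMem_tsupport fun h => ht ⟨hα' h, hβ' h⟩
  have hd : ∀ t, HasDerivAt (fun t => ∫ s in α..t, η s) (η t) t := fun t =>
    intervalIntegral.integral_hasDerivAt_right (hη.intervalIntegrable _ _)
      (hη.stronglyMeasurableAtFilter _ _) hη.continuousAt
  have hderiv : deriv (fun t => ∫ s in α..t, η s) = η := funext fun t => (hd t).deriv
  have hout : ∀ t, t ∉ Icc α β → ∫ s in α..t, η s = 0 := fun t ht => by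
    rw [mem_Icc, not_and_or, not_le, not_le] at ht
    rcases ht with ht | ht
    · refine intervalIntegral.integral_zero_ae ?_
      have : ∀ᵐ s : ℝ, s ≠ α := by simp [ae_iff]
      filter_upwards [this] with s hs hs'
      refine hz s fun h => hs ?_
      rw [uIoc_of_ge ht.le] at hs'
      exact le_antisymm hs'.2 h.1
    · have hab : α ≤ t := (hα' hβ).trans ht.le
      rw [intervalIntegral.integral_of_le hab, ← integral_Icc_eq_integral_Ioc,
        setIntegral_eq_integral_of_forall_compl_eq_zero, hη0]
      exact fun s hs => hz s fun h => hs ⟨h.1, h.2.trans ht.le⟩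
  refine ⟨fun t => ∫ s in α..t, η s, ⟨?_, ?_, ?_⟩, hderiv⟩
  · rw [contDiff_one_iff_deriv, hderiv]
    exact ⟨fun t => (hd t).differentiableAt, hη⟩
  · exact HasCompactSupport.intro (isCompact_Icc (a := α) (b := β)) hout
  · intro t ht
    have h1 : t ∈ Icc α β := by
      by_contra h
      exact ht (hout t h)
    exact ⟨(hηs hα).1.trans_le h1.1, h1.2.trans_lt (hηs hβ).2⟩

/-- A function with an integrable weak derivative `h` on `(0, T)` agrees almost everywhere with
a primitive of `h`. -/
theorem exists_ae_eq_primitive {T : ℝ} (hT : 0 < T) {g h : ℝ → ℝ}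
    (hg : IntervalIntegrable g volume 0 T) (hh : IntervalIntegrable h volume 0 T)
    (hgh : ∀ ξ, IsTestXi T ξ → ∫ t in (0:ℝ)..T, deriv ξ t * g t = - ∫ t in (0:ℝ)..T, ξ t * h t) :
    ∃ c, ∀ᵐ t ∂(volume.restrict (Icc 0 T)), g t = c + ∫ s in (0:ℝ)..t, h s := by
  set H : ℝ → ℝ := fun t => ∫ s in (0:ℝ)..t, h s with hH
  have hHac : AbsolutelyContinuousOnInterval H 0 T :=
    hh.absolutelyContinuousOnInterval_intervalIntegral left_mem_uIcc
  have hHint : IntervalIntegrable H volume 0 T := hHac.continuousOn.intervalIntegrable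
  have hHd : ∀ᵐ t, t ∈ uIoc 0 T → deriv H t = h t := by
    filter_upwards [hh.ae_hasDerivAt_integral] with t ht ht'
    exact (ht (uIoc_subset_uIcc ht') 0 left_mem_uIcc).deriv
  have hmean : ∀ η : ℝ → ℝ, Continuous η → HasCompactSupport η → tsupport η ⊆ Ioo 0 T →
      ∫ t, η t = 0 → ∫ t in (0:ℝ)..T, η t * (g t - H t) = 0 := fun η hη hηc hηs hη0 => by
    obtain ⟨ξ, hξ, rfl⟩ := exists_primitive_isTestXi hη hηc hηs hη0
    have hξac : AbsolutelyContinuousOnInterval ξ 0 T := hξ.1.contDiffOn.absolutelyContinuousOnInterval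
    have h0 : ξ 0 = 0 := by
      by_contra h
      exact lt_irrefl _ (hξ.2.2 h).1
    have hT0 : ξ T = 0 := by
      by_contra h
      exact lt_irrefl _ (hξ.2.2 h).2
    have h1 := hξac.integral_mul_deriv_eq_deriv_mul hHac
    rw [h0, hT0, zero_mul, zero_mul, sub_zero, zero_sub] at h1
    have h2 : ∫ t in (0:ℝ)..T, ξ t * deriv H t = ∫ t in (0:ℝ)..T, ξ t * h t :=
      intervalIntegral.integral_congr_ae (by
        filter_upwards [hHd] with t ht ht'
        rw [ht ht'])
    have h3 := hgh ξ hξ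
    simp only [mul_sub]
    rw [intervalIntegral.integral_sub (hg.continuousOn_mul hη.continuousOn)
      (hHint.continuousOn_mul hη.continuousOn), h3, ← h2, h1]
    ring
  let ρ : ContDiffBump (T / 2) := ⟨T / 8, T / 4, by positivity, by linarith⟩
  set η₀ := ρ.normed volume with hη₀
  have hη₀s : tsupport η₀ ⊆ Ioo 0 T := by
    rw [hη₀, ρ.tsupport_normed_eq, Real.closedBall_eq_Icc]
    intro t ht
    simp only [ρ, mem_Icc] at ht
    exact ⟨by linarith [ht.1], by linarith [ht.2]⟩
  set c := ∫ t in (0:ℝ)..T, η₀ t * (g t - H t) with hc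
  have hGint : IntervalIntegrable (fun t => g t - H t) volume 0 T := hg.sub hHint
  have hloc : LocallyIntegrableOn (fun t => g t - H t - c) (Ioo 0 T) volume := by
    have h1 := hGint.sub (intervalIntegrable_const (c := c) (μ := volume) (a := 0) (b := T))
    rw [intervalIntegrable_iff_integrableOn_Ioo_of_le hT.le] at h1
    exact h1.locallyIntegrableOn
  have hae := isOpen_Ioo.ae_eq_zero_of_integral_contDiff_smul_eq_zero hloc
    fun η hη hηc hηs => by
      set I := ∫ t, η t with hI
      have hηi : Integrable η := hη.continuous.integrable_of_hasCompactSupport hηc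
      have hη₀c : Continuous η₀ := ρ.continuous_normed
      have hprod : IntervalIntegrable (fun t => I * (η₀ t * (g t - H t))) volume 0 T :=
        (hGint.continuousOn_mul hη₀c.continuousOn).const_mul I
      have h1 := hmean (fun t => η t - I * η₀ t) (hη.continuous.sub (continuous_const.mul hη₀c))
        (hηc.sub (ρ.hasCompactSupport_normed.mul_left))
        ((tsupport_sub _ _).trans (union_subset hηs
          ((closure_mono (Function.support_mul_subset_right _ _)).trans hη₀s)))
        (by rw [integral_sub hηi (ρ.integrable_normed.const_mul _), integral_const_mul,
              ρ.integral_normed, mul_one, sub_self])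
      have h2 : ∫ t in (0:ℝ)..T, η t * (g t - H t) = I * c := by
        rw [hc, ← intervalIntegral.integral_const_mul, ← sub_eq_zero,
          ← intervalIntegral.integral_sub (hGint.continuousOn_mul hη.continuous.continuousOn)
          hprod, ← h1]
        congr 1
        ext t
        ring
      have h3 : ∫ t in (0:ℝ)..T, η t = I := by
        rw [intervalIntegral.integral_of_le hT.le]
        refine setIntegral_eq_integral_of_forall_compl_eq_zero fun t ht => ?_
        exact image_eq_zero_of_notMem_tsupport fun h => ht (Ioo_subset_Ioc_self (hηs h))
      have h4 : ∫ t, η t • (g t - H t - c) = ∫ t in (0:ℝ)..T, η t • (g t - H t - c) := by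
        rw [intervalIntegral.integral_of_le hT.le]
        refine (setIntegral_eq_integral_of_forall_compl_eq_zero fun t ht => ?_).symm
        rw [image_eq_zero_of_notMem_tsupport fun h => ht (Ioo_subset_Ioc_self (hηs h)), zero_smul]
      rw [h4]
      simp only [smul_eq_mul, mul_sub _ _ c]
      rw [intervalIntegral.integral_sub (hGint.continuousOn_mul hη.continuous.continuousOn)
        ((hη.continuous.intervalIntegrable 0 T).mul_const c), h2,
        intervalIntegral.integral_mul_const, h3, sub_self]
  refine ⟨c, ?_⟩
  rw [restrict_Ioo_eq_restrict_Icc.symm, ae_restrict_iff' measurableSet_Ioo]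
  filter_upwards [hae] with t ht ht'
  linarith [ht ht']

end DuBoisReymond

section Embedding

open Filter Topology

variable {E X : Type*} [TopologicalSpace E] [MeasurableSpace E] [BorelSpace E]
  [TopologicalSpace X] [MeasurableSpace X] [BorelSpace X] {j : E → X}

lemma ProbabilityMeasure.isEmbedding_map [HasOuterApproxClosed E] [HasOuterApproxClosed X]
    [FirstCountableTopology (ProbabilityMeasure X)] (hj : IsOpenEmbedding j) :
    IsEmbedding fun μ : ProbabilityMeasure E => μ.map hj.continuous.aemeasurable := by
  refine ⟨isInducing_iff_nhds.2 fun μ => le_antisymm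
    ((ProbabilityMeasure.continuous_map hj.continuous).tendsto μ).le_comap ?_, fun μ ν h => ?_⟩
  · refine tendsto_of_forall_isOpen_le_liminf' (μs := id) (L := comap
      (fun μ : ProbabilityMeasure E => μ.map hj.continuous.aemeasurable)
      (𝓝 (μ.map hj.continuous.aemeasurable))) fun G hG => ?_
    have h1 := (hj.isOpenMap G hG)
    have h2 : Tendsto (fun μ : ProbabilityMeasure E => μ.map hj.continuous.aemeasurable)
        (comap (fun μ : ProbabilityMeasure E => μ.map hj.continuous.aemeasurable)
          (𝓝 (μ.map hj.continuous.aemeasurable))) (𝓝 (μ.map hj.continuous.aemeasurable)) :=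
      tendsto_comap
    have h3 := ProbabilityMeasure.le_liminf_measure_open_of_tendsto h2 h1
    simpa [Measure.map_apply hj.continuous.measurable h1.measurableSet,
      preimage_image_eq G hj.injective] using h3
  · have h1 : (μ : Measure E).map j = (ν : Measure E).map j := by
      have := congrArg (fun ρ : ProbabilityMeasure X => (ρ : Measure X)) h
      simpa using this
    refine Subtype.ext (Measure.ext fun s hs => ?_)
    have h2 := hj.measurableEmbedding.measurableSet_image.2 hs
    have h3 := congrArg (fun ρ => ρ (j '' s)) h1
    simpa [Measure.map_apply hj.continuous.measurable h2,
      preimage_image_eq s hj.injective] using h3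

lemma ProbabilityMeasure.mem_range_map_iff (hj : IsOpenEmbedding j) (ν : ProbabilityMeasure X) :
    (∃ μ : ProbabilityMeasure E, μ.map hj.continuous.aemeasurable = ν) ↔
      (ν : Measure X) (range j) = 1 := by
  have hr : MeasurableSet (range j) := hj.isOpen_range.measurableSet
  constructor
  · rintro ⟨μ, rfl⟩
    simp [Measure.map_apply hj.continuous.measurable hr]
  · intro h
    have h1 : IsProbabilityMeasure ((ν : Measure X).comap j) := ⟨by
      rw [Measure.comap_apply _ hj.injective
        (fun s hs => hj.measurableEmbedding.measurableSet_image.2 hs) _ MeasurableSet.univ,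
        image_univ, h]⟩
    refine ⟨⟨_, h1⟩, Subtype.ext ?_⟩
    change Measure.map j ((ν : Measure X).comap j) = ν
    rw [hj.measurableEmbedding.map_comap, Measure.restrict_eq_self_of_ae_mem]
    exact (prob_compl_eq_zero_iff hr).2 h

lemma ProbabilityMeasure.lowerSemicontinuous_measure [HasOuterApproxClosed X] {G : Set X}
    (hG : IsOpen G) :
    LowerSemicontinuous fun ν : ProbabilityMeasure X => (ν : Measure X) G :=
  lowerSemicontinuous_iff_le_liminf.2 fun _ =>
    ProbabilityMeasure.le_liminf_measure_open_of_tendsto tendsto_id hG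

end Embedding

section Compactification

open Filter Topology

variable {d : ℕ}

instance : MeasurableSpace (OnePoint (Ed d)) := borel _

instance : BorelSpace (OnePoint (Ed d)) := ⟨rfl⟩

instance : TopologicalSpace.MetrizableSpace (OnePoint (Ed d)) :=
  (onePointEquivSphereOfFinrankEq (ι := Fin (d + 1)) (V := Ed d)
    (by simp)).isEmbedding.metrizableSpace

instance : BorelSpace (Pm d) := ⟨rfl⟩

/-- The compact space of probability measures on the one-point compactification of `ℝ^d`. -/
def CompactPm (d : ℕ) : Type := ProbabilityMeasure (OnePoint (Ed d))

instance : TopologicalSpace (CompactPm d) :=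
  inferInstanceAs (TopologicalSpace (ProbabilityMeasure (OnePoint (Ed d))))

instance : CompactSpace (CompactPm d) :=
  inferInstanceAs (CompactSpace (ProbabilityMeasure (OnePoint (Ed d))))

instance : TopologicalSpace.MetrizableSpace (CompactPm d) :=
  inferInstanceAs (TopologicalSpace.MetrizableSpace (ProbabilityMeasure (OnePoint (Ed d))))

instance : MeasurableSpace (CompactPm d) := borel _

instance : BorelSpace (CompactPm d) := ⟨rfl⟩

/-- The measure underlying a point of the compactification. -/
def CompactPm.toMeasure (ν : CompactPm d) : Measure (OnePoint (Ed d)) :=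
  (show ProbabilityMeasure (OnePoint (Ed d)) from ν : Measure (OnePoint (Ed d)))

instance (ν : CompactPm d) : IsProbabilityMeasure ν.toMeasure :=
  (show ProbabilityMeasure (OnePoint (Ed d)) from ν).2

/-- The inclusion of the probability measures on `ℝ^d` into their compactification. -/
def toCompactPm (μ : Pm d) : CompactPm d :=
  μ.map (OnePoint.isOpenEmbedding_coe (X := Ed d)).continuous.aemeasurable

lemma isEmbedding_toCompactPm : IsEmbedding (toCompactPm (d := d)) :=
  ProbabilityMeasure.isEmbedding_map OnePoint.isOpenEmbedding_coe

lemma range_toCompactPm : range (toCompactPm (d := d)) =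
    {ν | ν.toMeasure (range ((↑) : Ed d → OnePoint (Ed d))) = 1} := by
  ext ν
  exact ProbabilityMeasure.mem_range_map_iff OnePoint.isOpenEmbedding_coe ν

lemma measurable_measure_compactPm {G : Set (OnePoint (Ed d))} (hG : IsOpen G) :
    Measurable fun ν : CompactPm d => ν.toMeasure G :=
  LowerSemicontinuous.measurable
    (show LowerSemicontinuous fun ν : CompactPm d => ν.toMeasure G from
      ProbabilityMeasure.lowerSemicontinuous_measure hG)

lemma measurableEmbedding_toCompactPm : MeasurableEmbedding (toCompactPm (d := d)) := by
  refine isEmbedding_toCompactPm.measurableEmbedding ?_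
  rw [range_toCompactPm]
  exact measurable_measure_compactPm OnePoint.isOpenEmbedding_coe.isOpen_range
    (measurableSet_singleton 1)

/-- Extension by zero at infinity of a compactly supported continuous function. -/
def extendZero (φ : Ed d → ℝ) (h : Continuous φ) (hc : HasCompactSupport φ) :
    C(OnePoint (Ed d), ℝ) :=
  OnePoint.continuousMapMk ⟨φ, h⟩ 0 (by
    rw [coclosedCompact_eq_cocompact]
    exact hc.is_zero_at_infty)

/-- The continuous extension of `μ ↦ ∫ φ dμ` to the compactification. -/
def extendIntegral (φ : Ed d → ℝ) (h : Continuous φ) (hc : HasCompactSupport φ) :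
    C(CompactPm d, ℝ) where
  toFun ν := ∫ x, extendZero φ h hc x ∂ν.toMeasure
  continuous_toFun := by
    refine continuous_iff_continuousAt.2 fun ν => ?_
    exact ProbabilityMeasure.tendsto_iff_forall_integral_tendsto.1
      (tendsto_id (α := ProbabilityMeasure (OnePoint (Ed d))) (x := 𝓝 ν))
      (BoundedContinuousFunction.mkOfCompact (extendZero φ h hc))

lemma extendIntegral_toCompactPm (φ : Ed d → ℝ) (h : Continuous φ) (hc : HasCompactSupport φ)
    (μ : Pm d) : extendIntegral φ h hc (toCompactPm μ) = ∫ x, φ x ∂(μ : Measure (Ed d)) := by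
  change ∫ x, extendZero φ h hc x ∂((μ : Measure (Ed d)).map _) = _
  rw [OnePoint.isOpenEmbedding_coe.measurableEmbedding.integral_map]
  rfl

lemma abs_extendZero_le {φ : Ed d → ℝ} (h : Continuous φ) (hc : HasCompactSupport φ) {C : ℝ}
    (hC : ∀ x, |φ x| ≤ C) (x : OnePoint (Ed d)) : |extendZero φ h hc x| ≤ C := by
  induction x using OnePoint.rec with
  | infty =>
    change |(0:ℝ)| ≤ C
    rw [abs_zero]
    exact (abs_nonneg _).trans (hC 0)
  | coe x => exact hC x

lemma abs_extendIntegral_le {φ : Ed d → ℝ} (h : Continuous φ) (hc : HasCompactSupport φ) {C : ℝ}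
    (hC : ∀ x, |φ x| ≤ C) (ν : CompactPm d) : |extendIntegral φ h hc ν| ≤ C := by
  have h1 : ‖∫ x, extendZero φ h hc x ∂ν.toMeasure‖ ≤ C * ν.toMeasure.real univ :=
    norm_integral_le_of_norm_le_const (ae_of_all _ (abs_extendZero_le h hc hC))
  rwa [probReal_univ, mul_one] at h1

/-- A measure on the compactification is concentrated on probability measures on `ℝ^d` as soon as
it does not see mass at infinity. -/
lemma ae_mem_range_toCompactPm (ν : Measure (CompactPm d)) [IsProbabilityMeasure ν]
    (χ : ℕ → Ed d → ℝ) (hχ : ∀ n, Continuous (χ n)) (hχc : ∀ n, HasCompactSupport (χ n))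
    (hχ01 : ∀ n x, |χ n x| ≤ 1) (hlim : ∀ x, Tendsto (fun n => χ n x) atTop (𝓝 1))
    (hν : Tendsto (fun n => ∫ ρ, extendIntegral (χ n) (hχ n) (hχc n) ρ ∂ν) atTop (𝓝 1)) :
    ∀ᵐ ρ ∂ν, ρ ∈ range (toCompactPm (d := d)) := by
  have hr : MeasurableSet (range ((↑) : Ed d → OnePoint (Ed d))) :=
    OnePoint.isOpenEmbedding_coe.isOpen_range.measurableSet
  let w : CompactPm d → ℝ := fun ρ =>
    ρ.toMeasure.real (range ((↑) : Ed d → OnePoint (Ed d)))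
  have hwm : Measurable w :=
    (measurable_measure_compactPm OnePoint.isOpenEmbedding_coe.isOpen_range).ennreal_toReal
  have hw1 : ∀ ρ, w ρ ≤ 1 := fun ρ => measureReal_le_one
  have hpt : ∀ ρ, Tendsto (fun n => extendIntegral (χ n) (hχ n) (hχc n) ρ) atTop (𝓝 (w ρ)) := by
    intro ρ
    have h1 : w ρ = ∫ x, (range ((↑) : Ed d → OnePoint (Ed d))).indicator (fun _ => (1:ℝ)) x
        ∂ρ.toMeasure := by
      rw [integral_indicator_const _ hr]
      simp [w]
    rw [h1]
    refine tendsto_integral_of_dominated_convergence (fun _ => 1)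
      (fun n => (extendZero (χ n) (hχ n) (hχc n)).continuous.aestronglyMeasurable)
      (integrable_const _) (fun n => ae_of_all _ (abs_extendZero_le _ _ (hχ01 n)))
      (ae_of_all _ fun x => ?_)
    induction x using OnePoint.rec with
    | infty =>
      rw [indicator_of_notMem (by simp)]
      exact tendsto_const_nhds
    | coe x =>
      rw [indicator_of_mem (mem_range_self x)]
      exact hlim x
  have h2 : Tendsto (fun n => ∫ ρ, extendIntegral (χ n) (hχ n) (hχc n) ρ ∂ν) atTop
      (𝓝 (∫ ρ, w ρ ∂ν)) :=
    tendsto_integral_of_dominated_convergence (fun _ => 1)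
      (fun n => (extendIntegral (χ n) (hχ n) (hχc n)).continuous.aestronglyMeasurable)
      (integrable_const _) (fun n => ae_of_all _ (abs_extendIntegral_le _ _ (hχ01 n)))
      (ae_of_all _ hpt)
  have h3 : ∫ ρ, w ρ ∂ν = 1 := tendsto_nhds_unique h2 hν
  have hwi : Integrable w ν := Integrable.of_bound hwm.aestronglyMeasurable 1
    (ae_of_all _ fun ρ => by
      rw [Real.norm_eq_abs, abs_of_nonneg measureReal_nonneg]
      exact hw1 ρ)
  have h4 : ∫ ρ, (1 - w ρ) ∂ν = 0 := by
    rw [integral_sub (integrable_const _) hwi, h3]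
    simp
  have h5 := (integral_eq_zero_iff_of_nonneg (fun ρ => sub_nonneg.2 (hw1 ρ))
    ((integrable_const _).sub hwi)).1 h4
  filter_upwards [h5] with ρ hρ
  rw [range_toCompactPm]
  have h6 : w ρ = 1 := by
    have : 1 - w ρ = 0 := hρ
    linarith
  exact (ENNReal.toReal_eq_one_iff _).1 h6

end Compactification

section Generator

variable {d : ℕ}

/-- The weighted bounds on the first two derivatives of a test function. -/
def WeightedBound (φ : Ed d → ℝ) (C : ℝ) : Prop :=
  (∀ x, (1 + ‖x‖) * ‖iteratedFDeriv ℝ 1 φ x‖ ≤ C) ∧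
    ∀ x, (1 + ‖x‖ ^ 2) * ‖iteratedFDeriv ℝ 2 φ x‖ ≤ C

/-- The test functions in the unit ball defining `D2w`. -/
def IsUnitTest (φ : Ed d → ℝ) : Prop :=
  ContDiff ℝ 2 φ ∧ HasCompactSupport φ ∧
    ∃ A B C : ℝ, A + B + C ≤ 1 ∧ (∀ x, |φ x| ≤ A) ∧
      (∀ x, (1 + ‖x‖) * ‖iteratedFDeriv ℝ 1 φ x‖ ≤ B) ∧
      (∀ x, (1 + ‖x‖ ^ 2) * ‖iteratedFDeriv ℝ 2 φ x‖ ≤ C)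

lemma IsUnitTest.isTestPhi {φ : Ed d → ℝ} (h : IsUnitTest φ) : IsTestPhi φ := ⟨h.1, h.2.1⟩

lemma IsUnitTest.abs_le_one {φ : Ed d → ℝ} (h : IsUnitTest φ) (x : Ed d) : |φ x| ≤ 1 := by
  obtain ⟨A, B, C, hs, hA, hB, hC⟩ := h.2.2
  have h1 : 0 ≤ B := le_trans (by positivity) (hB x)
  have h2 : 0 ≤ C := le_trans (by positivity) (hC x)
  linarith [hA x]

lemma IsUnitTest.weightedBound {φ : Ed d → ℝ} (h : IsUnitTest φ) : WeightedBound φ 1 := by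
  obtain ⟨A, B, C, hs, hA, hB, hC⟩ := h.2.2
  have h0 : 0 ≤ A := le_trans (by positivity) (hA 0)
  have h1 : 0 ≤ B := le_trans (by positivity) (hB 0)
  have h2 : 0 ≤ C := le_trans (by positivity) (hC 0)
  exact ⟨fun x => by linarith [hB x], fun x => by linarith [hC x]⟩

lemma IsTestPhi.exists_weightedBound {φ : Ed d → ℝ} (h : IsTestPhi φ) :
    ∃ C, 0 ≤ C ∧ (∀ x, |φ x| ≤ C) ∧ WeightedBound φ C := by
  have key : ∀ (n : ℕ) (w : Ed d → ℝ), (n : ℕ∞) ≤ 2 → Continuous w →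
      ∃ C, ∀ x, ‖w x * ‖iteratedFDeriv ℝ n φ x‖‖ ≤ C := fun n w hn hw => by
    have h1 : Continuous (iteratedFDeriv ℝ n φ) := h.1.continuous_iteratedFDeriv (mod_cast hn)
    exact ((h.2.iteratedFDeriv n).norm.mul_left).exists_bound_of_continuous (hw.mul h1.norm)
  obtain ⟨A, hA⟩ := h.2.exists_bound_of_continuous h.1.continuous
  obtain ⟨B, hB⟩ := key 1 (fun x => 1 + ‖x‖) (by norm_num) (by fun_prop)
  obtain ⟨C, hC⟩ := key 2 (fun x => 1 + ‖x‖ ^ 2) le_rfl (by fun_prop)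
  refine ⟨max (max A B) C, ?_, fun x => ?_, fun x => ?_, fun x => ?_⟩
  · exact (norm_nonneg _).trans ((hA 0).trans (by simp))
  · exact (hA x).trans (by simp)
  · exact (le_abs_self _).trans ((hB x).trans (by simp))
  · exact (le_abs_self _).trans ((hC x).trans (by simp))

lemma norm_gradient_eq (φ : Ed d → ℝ) (x : Ed d) :
    ‖gradient φ x‖ = ‖iteratedFDeriv ℝ 1 φ x‖ := by
  rw [norm_iteratedFDeriv_one, gradient, LinearIsometryEquiv.norm_map]

lemma norm_fderiv_gradient_eq (φ : Ed d → ℝ) (x : Ed d) :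
    ‖fderiv ℝ (gradient φ) x‖ = ‖iteratedFDeriv ℝ 2 φ x‖ := by
  have h1 : gradient φ = (InnerProductSpace.toDual ℝ (Ed d)).symm ∘ fderiv ℝ φ := rfl
  have h2 : ‖iteratedFDeriv ℝ 2 φ x‖ = ‖fderiv ℝ (fderiv ℝ φ) x‖ := by
    rw [← norm_iteratedFDeriv_one, norm_iteratedFDeriv_fderiv]
  rw [h1, h2, LinearIsometryEquiv.comp_fderiv]
  exact LinearIsometry.norm_toContinuousLinearMap_comp
    ((InnerProductSpace.toDual ℝ (Ed d)).symm.toLinearIsometry)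

lemma abs_trace_le (A : Ed d →L[ℝ] Ed d) :
    |LinearMap.trace ℝ (Ed d) A.toLinearMap| ≤ d * ‖A‖ := by
  rw [LinearMap.trace_eq_sum_inner _ (EuclideanSpace.basisFun (Fin d) ℝ)]
  refine (Finset.abs_sum_le_sum_abs _ _).trans ?_
  have h1 : ∀ i ∈ Finset.univ, |⟪EuclideanSpace.basisFun (Fin d) ℝ i,
      A.toLinearMap (EuclideanSpace.basisFun (Fin d) ℝ i)⟫| ≤ ‖A‖ := fun i _ => by
    refine (abs_real_inner_le_norm _ _).trans ?_
    have h2 := A.le_opNorm (EuclideanSpace.basisFun (Fin d) ℝ i)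
    rw [OrthonormalBasis.norm_eq_one, mul_one] at h2
    rw [OrthonormalBasis.norm_eq_one, one_mul]
    exact h2
  simpa using Finset.sum_le_card_nsmul _ _ _ h1

variable (b : ℝ → Ed d → Pm d → Ed d) (a : ℝ → Ed d → Pm d → (Ed d →L[ℝ] Ed d))

lemma wInt_nonneg (t : ℝ) (x : Ed d) (μ : Pm d) : 0 ≤ wInt b a t x μ := by
  unfold wInt
  positivity

lemma abs_Lop_le {φ : Ed d → ℝ} {C : ℝ} (h : WeightedBound φ C) (μ : Pm d) (t : ℝ) (x : Ed d) :
    |Lop b a μ t φ x| ≤ C * (1 + d) * wInt b a t x μ := by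
  have hC : 0 ≤ C := le_trans (by positivity) (h.1 0)
  have h1 : |⟪b t x μ, gradient φ x⟫| ≤ C * (‖b t x μ‖ / (1 + ‖x‖)) := by
    refine (abs_real_inner_le_norm _ _).trans ?_
    rw [norm_gradient_eq, mul_div_left_comm, div_eq_mul_inv]
    gcongr
    rw [← div_eq_mul_inv, le_div_iff₀ (by positivity), mul_comm]
    exact h.1 x
  have h2 : |LinearMap.trace ℝ (Ed d) ((a t x μ ∘L fderiv ℝ (gradient φ) x).toLinearMap)| ≤
      d * (C * (‖a t x μ‖ / (1 + ‖x‖ ^ 2))) := by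
    refine (abs_trace_le _).trans ?_
    gcongr
    refine (ContinuousLinearMap.opNorm_comp_le _ _).trans ?_
    rw [norm_fderiv_gradient_eq, mul_div_left_comm, div_eq_mul_inv]
    gcongr
    rw [← div_eq_mul_inv, le_div_iff₀ (by positivity), mul_comm]
    exact h.2 x
  have h3 : 0 ≤ ‖b t x μ‖ / (1 + ‖x‖) := by positivity
  have h4 : 0 ≤ ‖a t x μ‖ / (1 + ‖x‖ ^ 2) := by positivity
  have h5 : |Lop b a μ t φ x| ≤ C * (‖b t x μ‖ / (1 + ‖x‖)) +
      1 / 2 * (d * (C * (‖a t x μ‖ / (1 + ‖x‖ ^ 2)))) := by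
    unfold Lop
    refine (abs_add_le _ _).trans (add_le_add h1 ?_)
    rw [abs_mul, abs_of_nonneg (by norm_num : (0:ℝ) ≤ 1 / 2)]
    gcongr
  refine h5.trans ?_
  unfold wInt
  have h6 : 0 ≤ (d : ℝ) * (C * (‖b t x μ‖ / (1 + ‖x‖))) := by positivity
  have h7 : 0 ≤ (d : ℝ) * (C * (‖a t x μ‖ / (1 + ‖x‖ ^ 2))) := by positivity
  have h8 : 0 ≤ C * (‖a t x μ‖ / (1 + ‖x‖ ^ 2)) := by positivity
  nlinarith

lemma ContDiff.contDiff_gradient {φ : Ed d → ℝ} (h : ContDiff ℝ 2 φ) :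
    ContDiff ℝ 1 (gradient φ) :=
  (InnerProductSpace.toDual ℝ (Ed d)).symm.contDiff.comp (h.fderiv_right (by norm_num))

end Generator

section Measurability

variable {d : ℕ}

lemma measurable_coe_Pm : Measurable fun μ : Pm d => (μ : Measure (Ed d)) := by
  refine Measurable.measure_of_isPiSystem_of_isProbabilityMeasure
    (BorelSpace.measurable_eq (α := Ed d)) isPiSystem_isOpen fun G hG => ?_
  exact LowerSemicontinuous.measurable
    (show LowerSemicontinuous fun μ : Pm d => (μ : Measure (Ed d)) G from
      ProbabilityMeasure.lowerSemicontinuous_measure hG)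

open ProbabilityTheory

/-- The tautological kernel from `P(ℝ^d)` to `ℝ^d`. -/
def pmKernel (d : ℕ) : Kernel (Pm d) (Ed d) := ⟨fun μ => (μ : Measure (Ed d)), measurable_coe_Pm⟩

instance : IsMarkovKernel (pmKernel d) := ⟨fun μ => μ.2⟩

variable {b : ℝ → Ed d → Pm d → Ed d} {a : ℝ → Ed d → Pm d → (Ed d →L[ℝ] Ed d)}

lemma measurable_wInt (hb : Measurable fun p : ℝ × Ed d × Pm d => b p.1 p.2.1 p.2.2)
    (ha : Measurable fun p : ℝ × Ed d × Pm d => a p.1 p.2.1 p.2.2) :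
    Measurable fun p : (ℝ × Pm d) × Ed d => wInt b a p.1.1 p.2 p.1.2 := by
  have hperm : Measurable fun p : (ℝ × Pm d) × Ed d => (p.1.1, p.2, p.1.2) := by fun_prop
  have hb' := (hb.comp hperm).norm
  have ha' := (ha.comp hperm).norm
  simp only [Function.comp_def] at hb' ha'
  unfold wInt
  fun_prop

lemma measurable_Lop (hb : Measurable fun p : ℝ × Ed d × Pm d => b p.1 p.2.1 p.2.2)
    (ha : Measurable fun p : ℝ × Ed d × Pm d => a p.1 p.2.1 p.2.2)
    {φ : Ed d → ℝ} (hφ : ContDiff ℝ 2 φ) :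
    Measurable fun p : (ℝ × Pm d) × Ed d => Lop b a p.1.2 p.1.1 φ p.2 := by
  have hperm : Measurable fun p : (ℝ × Pm d) × Ed d => (p.1.1, p.2, p.1.2) := by fun_prop
  have hb' := (hb.comp hperm)
  have ha' := (ha.comp hperm)
  simp only [Function.comp_def] at hb' ha'
  have hg := hφ.contDiff_gradient
  have hg1 : Measurable fun p : (ℝ × Pm d) × Ed d => gradient φ p.2 :=
    hg.continuous.measurable.comp measurable_snd
  have hg2 : Measurable fun p : (ℝ × Pm d) × Ed d => fderiv ℝ (gradient φ) p.2 :=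
    (hg.continuous_fderiv (by norm_num)).measurable.comp measurable_snd
  have htr : Continuous fun q : (Ed d →L[ℝ] Ed d) × (Ed d →L[ℝ] Ed d) =>
      LinearMap.trace ℝ (Ed d) ((q.1 ∘L q.2).toLinearMap) := by
    simp only [LinearMap.trace_eq_sum_inner _ (EuclideanSpace.basisFun (Fin d) ℝ)]
    refine continuous_finsetSum _ fun i _ => ?_
    refine continuous_const.inner ?_
    exact (continuous_fst.clm_comp continuous_snd).clm_apply continuous_const
  unfold Lop
  exact (hb'.inner hg1).add ((htr.measurable.comp (ha'.prodMk hg2)).const_mul _)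

end Measurability

section RandomIntegrals

open ProbabilityTheory

variable {d : ℕ}

lemma continuous_LPhi {k : ℕ} {Φ : Fin k → Ed d → ℝ} (hΦ : ∀ i, IsTestPhi (Φ i)) :
    Continuous (LPhi Φ) := by
  refine continuous_pi fun i => ?_
  have h1 := (extendIntegral (Φ i) (hΦ i).1.continuous (hΦ i).2).continuous.comp
    isEmbedding_toCompactPm.continuous
  exact h1.congr fun μ => extendIntegral_toCompactPm _ _ _ μ

/-- A measurable curve of measures on `P(ℝ^d)`, as a kernel. -/
def curveKernel (M : ℝ → Measure (Pm d))
    (hM : ∀ A : Set (Pm d), MeasurableSet A → Measurable fun t => M t A) : Kernel ℝ (Pm d) :=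
  ⟨M, Measure.measurable_of_measurable_coe M hM⟩

variable {M : ℝ → Measure (Pm d)} [∀ t, IsProbabilityMeasure (M t)]

lemma isMarkovKernel_curveKernel
    (hM : ∀ A : Set (Pm d), MeasurableSet A → Measurable fun t => M t A) :
    IsMarkovKernel (curveKernel M hM) :=
  ⟨fun t => inferInstanceAs (IsProbabilityMeasure (M t))⟩

lemma measurable_integral_curve
    (hM : ∀ A : Set (Pm d), MeasurableSet A → Measurable fun t => M t A)
    {f : ℝ × Pm d → ℝ} (hf : Measurable f) : Measurable fun t => ∫ μ, f (t, μ) ∂(M t) := by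
  have := isMarkovKernel_curveKernel hM
  exact (hf.stronglyMeasurable.integral_kernel_prod_right' (κ := curveKernel M hM)).measurable

omit [∀ t, IsProbabilityMeasure (M t)] in
lemma measurable_integral_pm {f : (ℝ × Pm d) × Ed d → ℝ} (hf : Measurable f) :
    Measurable fun p : ℝ × Pm d => ∫ x, f (p, x) ∂(p.2 : Measure (Ed d)) :=
  (hf.stronglyMeasurable.integral_kernel_prod_right'
    (κ := (pmKernel d).comap Prod.snd measurable_snd)).measurable

variable (b : ℝ → Ed d → Pm d → Ed d) (a : ℝ → Ed d → Pm d → (Ed d →L[ℝ] Ed d))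

variable (M) in
/-- The spatial integral of the weighted coefficients. -/
def wTotal (t : ℝ) : ℝ≥0∞ :=
  ∫⁻ μ, ∫⁻ x, ENNReal.ofReal (wInt b a t x μ) ∂(μ : Measure (Ed d)) ∂(M t)

variable {b a}

lemma measurable_lintegral_wInt (hb : Measurable fun p : ℝ × Ed d × Pm d => b p.1 p.2.1 p.2.2)
    (ha : Measurable fun p : ℝ × Ed d × Pm d => a p.1 p.2.1 p.2.2) :
    Measurable fun p : ℝ × Pm d =>
      ∫⁻ x, ENNReal.ofReal (wInt b a p.1 x p.2) ∂(p.2 : Measure (Ed d)) :=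
  (measurable_wInt hb ha).ennreal_ofReal.lintegral_kernel_prod_right'
    (κ := (pmKernel d).comap Prod.snd measurable_snd)

lemma measurable_wTotal (hb : Measurable fun p : ℝ × Ed d × Pm d => b p.1 p.2.1 p.2.2)
    (ha : Measurable fun p : ℝ × Ed d × Pm d => a p.1 p.2.1 p.2.2)
    (hM : ∀ A : Set (Pm d), MeasurableSet A → Measurable fun t => M t A) :
    Measurable (wTotal M b a) := by
  have := isMarkovKernel_curveKernel hM
  exact (measurable_lintegral_wInt hb ha).lintegral_kernel_prod_right'
    (κ := curveKernel M hM)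

omit [∀ t, IsProbabilityMeasure (M t)] in
lemma enorm_integral_integral_le {f : Pm d → Ed d → ℝ} {C t : ℝ} (hC : 0 ≤ C)
    (hf : ∀ μ x, |f μ x| ≤ C * wInt b a t x μ) :
    ‖∫ μ, ∫ x, f μ x ∂(μ : Measure (Ed d)) ∂(M t)‖ₑ ≤ ENNReal.ofReal C * wTotal M b a t := by
  unfold wTotal
  rw [← lintegral_const_mul' _ _ ENNReal.ofReal_ne_top]
  refine (enorm_integral_le_lintegral_enorm _).trans (lintegral_mono fun μ => ?_)
  rw [← lintegral_const_mul' _ _ ENNReal.ofReal_ne_top]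
  refine (enorm_integral_le_lintegral_enorm _).trans (lintegral_mono fun x => ?_)
  rw [← ENNReal.ofReal_mul hC, Real.enorm_eq_ofReal_abs]
  exact ENNReal.ofReal_le_ofReal (hf μ x)

lemma integrableOn_integral_integral
    (hM : ∀ A : Set (Pm d), MeasurableSet A → Measurable fun t => M t A)
    {T : ℝ} (hint : ∫⁻ t in Icc 0 T, wTotal M b a t < ∞)
    {f : (ℝ × Pm d) × Ed d → ℝ} (hfm : Measurable f) {C : ℝ} (hC : 0 ≤ C)
    (hf : ∀ t μ x, |f ((t, μ), x)| ≤ C * wInt b a t x μ) :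
    IntegrableOn (fun t => ∫ μ, ∫ x, f ((t, μ), x) ∂(μ : Measure (Ed d)) ∂(M t)) (Icc 0 T) := by
  refine ⟨(measurable_integral_curve hM (measurable_integral_pm hfm)).aestronglyMeasurable, ?_⟩
  refine (lintegral_mono fun t => enorm_integral_integral_le hC (hf t)).trans_lt ?_
  rw [lintegral_const_mul' _ _ ENNReal.ofReal_ne_top]
  exact ENNReal.mul_lt_top ENNReal.ofReal_lt_top hint

omit [∀ t, IsProbabilityMeasure (M t)] in
lemma ae_integrable_of_wTotal_lt_top
    (hb : Measurable fun p : ℝ × Ed d × Pm d => b p.1 p.2.1 p.2.2)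
    (ha : Measurable fun p : ℝ × Ed d × Pm d => a p.1 p.2.1 p.2.2)
    {t : ℝ} (ht : wTotal M b a t < ∞) :
    ∀ᵐ μ ∂(M t), ∀ φ, IsTestPhi φ → Integrable (Lop b a μ t φ) (μ : Measure (Ed d)) := by
  have h1 := ae_lt_top ((measurable_lintegral_wInt hb ha).comp
    (measurable_const.prodMk measurable_id : Measurable fun μ : Pm d => (t, μ))) ht.ne
  filter_upwards [h1] with μ hμ φ hφ
  obtain ⟨C, hC, -, hCφ⟩ := hφ.exists_weightedBound
  refine ⟨((measurable_Lop hb ha hφ.1).comp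
    (measurable_const.prodMk measurable_id :
      Measurable fun x : Ed d => ((t, μ), x))).aestronglyMeasurable, ?_⟩
  refine lt_of_le_of_lt ?_ (ENNReal.mul_lt_top (ENNReal.ofReal_lt_top (r := C * (1 + d))) hμ)
  rw [Function.comp_apply, ← lintegral_const_mul' _ _ ENNReal.ofReal_ne_top]
  refine lintegral_mono fun x => ?_
  rw [← ENNReal.ofReal_mul (by positivity), Real.enorm_eq_ofReal_abs]
  exact ENNReal.ofReal_le_ofReal (abs_Lop_le b a hCφ μ t x)

variable (b a) in
/-- The integrand of the derivative of a cylinder function along the curve. -/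
def cylDeriv {k : ℕ} (Ψ : (Fin k → ℝ) → ℝ) (Φ : Fin k → Ed d → ℝ)
    (p : (ℝ × Pm d) × Ed d) : ℝ :=
  ∑ i, fderiv ℝ Ψ (LPhi Φ p.1.2) (Pi.single i 1) * Lop b a p.1.2 p.1.1 (Φ i) p.2

lemma measurable_cylDeriv (hb : Measurable fun p : ℝ × Ed d × Pm d => b p.1 p.2.1 p.2.2)
    (ha : Measurable fun p : ℝ × Ed d × Pm d => a p.1 p.2.1 p.2.2)
    {k : ℕ} {Ψ : (Fin k → ℝ) → ℝ} {Φ : Fin k → Ed d → ℝ} (hΨ : ContDiff ℝ 1 Ψ)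
    (hΦ : ∀ i, IsTestPhi (Φ i)) : Measurable (cylDeriv b a Ψ Φ) := by
  refine Finset.measurable_sum _ fun i _ => ?_
  refine Measurable.mul ?_ (measurable_Lop hb ha (hΦ i).1)
  have h1 : Continuous fun μ : Pm d => fderiv ℝ Ψ (LPhi Φ μ) (Pi.single i 1) :=
    ((hΨ.continuous_fderiv (by norm_num)).comp (continuous_LPhi hΦ)).clm_apply continuous_const
  exact h1.measurable.comp (measurable_snd.comp measurable_fst)

lemma exists_abs_cylDeriv_le {k : ℕ} {Ψ : (Fin k → ℝ) → ℝ} {Φ : Fin k → Ed d → ℝ}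
    (hΨ : ContDiff ℝ 1 Ψ) (hΨc : HasCompactSupport Ψ) (hΦ : ∀ i, IsTestPhi (Φ i)) :
    ∃ C, 0 ≤ C ∧ ∀ t μ x, |cylDeriv b a Ψ Φ ((t, μ), x)| ≤ C * wInt b a t x μ := by
  obtain ⟨D, hD⟩ := (hΨc.fderiv ℝ).exists_bound_of_continuous (hΨ.continuous_fderiv (by norm_num))
  have hD0 : 0 ≤ D := (norm_nonneg _).trans (hD 0)
  choose C hC0 hC hCw using fun i => (hΦ i).exists_weightedBound
  refine ⟨∑ i, D * (C i * (1 + d)), Finset.sum_nonneg fun i _ => by have := hC0 i; positivity,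
    fun t μ x => ?_⟩
  rw [Finset.sum_mul]
  refine (Finset.abs_sum_le_sum_abs _ _).trans (Finset.sum_le_sum fun i _ => ?_)
  rw [abs_mul, mul_assoc]
  refine mul_le_mul ?_ (abs_Lop_le b a (hCw i) μ t x) (abs_nonneg _) hD0
  have h1 := (fderiv ℝ Ψ (LPhi Φ μ)).le_opNorm (Pi.single i 1)
  rw [Pi.norm_single, norm_one, mul_one] at h1
  exact h1.trans (hD _)

lemma abs_cylDeriv_le {k : ℕ} {Ψ : (Fin k → ℝ) → ℝ} {Φ : Fin k → Ed d → ℝ}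
    (hΨ : LipschitzWith 1 Ψ) (hΦ : ∀ i, WeightedBound (Φ i) 1) (t : ℝ) (μ : Pm d) (x : Ed d) :
    |cylDeriv b a Ψ Φ ((t, μ), x)| ≤ (1 + d) * wInt b a t x μ := by
  let v : Fin k → ℝ := fun i => Lop b a μ t (Φ i) x
  have h1 : cylDeriv b a Ψ Φ ((t, μ), x) = fderiv ℝ Ψ (LPhi Φ μ) v := by
    conv_rhs => rw [← Finset.univ_sum_single v, map_sum]
    refine Finset.sum_congr rfl fun i _ => ?_
    have h2 : Pi.single i (v i) = v i • (Pi.single i 1 : Fin k → ℝ) := by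
      rw [← Pi.single_smul, smul_eq_mul, mul_one]
    rw [h2, map_smul, smul_eq_mul, mul_comm]
  have h3 := (fderiv ℝ Ψ (LPhi Φ μ)).le_of_opNorm_le (norm_fderiv_le_of_lipschitz ℝ hΨ) v
  rw [NNReal.coe_one, one_mul] at h3
  rw [h1]
  refine h3.trans ((pi_norm_le_iff_of_nonneg ?_).2 fun i => ?_)
  · have := wInt_nonneg b a t x μ
    positivity
  · simpa using abs_Lop_le b a (hΦ i) μ t x

omit [∀ t, IsProbabilityMeasure (M t)] in
lemma integral_cylDeriv_eq
    (hb : Measurable fun p : ℝ × Ed d × Pm d => b p.1 p.2.1 p.2.2)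
    (ha : Measurable fun p : ℝ × Ed d × Pm d => a p.1 p.2.1 p.2.2)
    {k : ℕ} (Ψ : (Fin k → ℝ) → ℝ) {Φ : Fin k → Ed d → ℝ} (hΦ : ∀ i, IsTestPhi (Φ i))
    {t : ℝ} (ht : wTotal M b a t < ∞) :
    ∫ μ, ∫ x, cylDeriv b a Ψ Φ ((t, μ), x) ∂(μ : Measure (Ed d)) ∂(M t) =
      ∫ μ, (∑ i, fderiv ℝ Ψ (LPhi Φ μ) (Pi.single i 1) *
        ∫ x, Lop b a μ t (Φ i) x ∂(μ : Measure (Ed d))) ∂(M t) := by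
  refine integral_congr_ae ?_
  filter_upwards [ae_integrable_of_wTotal_lt_top hb ha ht] with μ hμ
  simp only [cylDeriv]
  rw [integral_finsetSum _ fun i _ => (hμ (Φ i) (hΦ i)).const_mul _]
  exact Finset.sum_congr rfl fun i _ => integral_const_mul _ _

lemma integrableOn_integral_cylinder
    (hM : ∀ A : Set (Pm d), MeasurableSet A → Measurable fun t => M t A)
    {F : Pm d → ℝ} (hF : Continuous F) {C : ℝ} (hC : ∀ μ, |F μ| ≤ C) (T : ℝ) :
    IntegrableOn (fun t => ∫ μ, F μ ∂(M t)) (Icc 0 T) := by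
  refine Integrable.of_bound (measurable_integral_curve hM
    (hF.measurable.comp measurable_snd)).aestronglyMeasurable C (ae_of_all _ fun t => ?_)
  have h1 := norm_integral_le_of_norm_le_const (μ := M t) (f := F) (C := C) (ae_of_all _ hC)
  rwa [probReal_univ, mul_one] at h1

end RandomIntegrals

section CylBound

open Filter Topology

variable {d : ℕ}

/-- The continuous extension of `LPhi Φ` to the compactification. -/
def extLPhi {k : ℕ} (Φ : Fin k → Ed d → ℝ) (hΦ : ∀ i, IsTestPhi (Φ i)) (ρ : CompactPm d) :
    Fin k → ℝ :=
  fun i => extendIntegral (Φ i) (hΦ i).1.continuous (hΦ i).2 ρ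

lemma continuous_extLPhi {k : ℕ} {Φ : Fin k → Ed d → ℝ} (hΦ : ∀ i, IsTestPhi (Φ i)) :
    Continuous (extLPhi Φ hΦ) :=
  continuous_pi fun i => (extendIntegral (Φ i) (hΦ i).1.continuous (hΦ i).2).continuous

lemma extLPhi_toCompactPm {k : ℕ} {Φ : Fin k → Ed d → ℝ} (hΦ : ∀ i, IsTestPhi (Φ i)) (μ : Pm d) :
    extLPhi Φ hΦ (toCompactPm μ) = LPhi Φ μ :=
  funext fun _ => extendIntegral_toCompactPm _ _ _ μ

lemma norm_extLPhi_le {k : ℕ} {Φ : Fin k → Ed d → ℝ} (hΦ : ∀ i, IsUnitTest (Φ i))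
    (ρ : CompactPm d) : ‖extLPhi Φ (fun i => (hΦ i).isTestPhi) ρ‖ ≤ 1 :=
  (pi_norm_le_iff_of_nonneg zero_le_one).2 fun i => abs_extendIntegral_le _ _ (hΦ i).abs_le_one ρ

/-- Two measures on the compactification differ by at most `V` when tested against Lipschitz
cylinder functions over unit test functions. -/
def CylBound (ν₁ ν₂ : Measure (CompactPm d)) (V : ℝ) : Prop :=
  ∀ (k : ℕ) (Φ : Fin k → Ed d → ℝ) (hΦ : ∀ i, IsUnitTest (Φ i)) (u : (Fin k → ℝ) → ℝ),
    LipschitzWith 1 u →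
    |∫ ρ, u (extLPhi Φ (fun i => (hΦ i).isTestPhi) ρ) ∂ν₁ -
      ∫ ρ, u (extLPhi Φ (fun i => (hΦ i).isTestPhi) ρ) ∂ν₂| ≤ V

lemma CylBound.refl (ν : Measure (CompactPm d)) : CylBound ν ν 0 := fun k Φ hΦ u hu => by simp

lemma CylBound.symm {ν₁ ν₂ : Measure (CompactPm d)} {V : ℝ} (h : CylBound ν₁ ν₂ V) :
    CylBound ν₂ ν₁ V := fun k Φ hΦ u hu => by
  rw [abs_sub_comm]
  exact h k Φ hΦ u hu

lemma CylBound.trans {ν₁ ν₂ ν₃ : Measure (CompactPm d)} {V W : ℝ} (h : CylBound ν₁ ν₂ V)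
    (h' : CylBound ν₂ ν₃ W) : CylBound ν₁ ν₃ (V + W) := fun k Φ hΦ u hu =>
  (abs_sub_le _ _ _).trans (add_le_add (h k Φ hΦ u hu) (h' k Φ hΦ u hu))

/-- It suffices to check cylinder functions of class `C_c¹`. -/
lemma CylBound.of_contDiff {ν₁ ν₂ : Measure (CompactPm d)} [IsProbabilityMeasure ν₁]
    [IsProbabilityMeasure ν₂] {V : ℝ}
    (h : ∀ (k : ℕ) (Φ : Fin k → Ed d → ℝ) (hΦ : ∀ i, IsUnitTest (Φ i)) (u : (Fin k → ℝ) → ℝ),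
      LipschitzWith 1 u → ContDiff ℝ 1 u → HasCompactSupport u →
      |∫ ρ, u (extLPhi Φ (fun i => (hΦ i).isTestPhi) ρ) ∂ν₁ -
        ∫ ρ, u (extLPhi Φ (fun i => (hΦ i).isTestPhi) ρ) ∂ν₂| ≤ V) : CylBound ν₁ ν₂ V := by
  intro k Φ hΦ u hu
  refine le_of_forall_pos_le_add fun ε hε => ?_
  obtain ⟨v, hv, hvc, hvl, hvu⟩ := exists_contDiff_lipschitz_approx hu 1 (half_pos hε)
  have hc := continuous_extLPhi fun i => (hΦ i).isTestPhi
  have key : ∀ (ν : Measure (CompactPm d)) [IsProbabilityMeasure ν],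
      |∫ ρ, v (extLPhi Φ (fun i => (hΦ i).isTestPhi) ρ) ∂ν -
        ∫ ρ, u (extLPhi Φ (fun i => (hΦ i).isTestPhi) ρ) ∂ν| ≤ ε / 2 := fun ν _ => by
    have hvi : Integrable (fun ρ => v (extLPhi Φ (fun i => (hΦ i).isTestPhi) ρ)) ν :=
      integrable_continuousMap ν (hv.continuous.comp hc)
    have hui : Integrable (fun ρ => u (extLPhi Φ (fun i => (hΦ i).isTestPhi) ρ)) ν :=
      integrable_continuousMap ν (hu.continuous.comp hc)
    rw [← integral_sub hvi hui]
    have h1 := norm_integral_le_of_norm_le_const (μ := ν) (C := ε / 2)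
      (f := fun ρ => v (extLPhi Φ (fun i => (hΦ i).isTestPhi) ρ) -
        u (extLPhi Φ (fun i => (hΦ i).isTestPhi) ρ))
      (ae_of_all _ fun ρ => hvu _ (norm_extLPhi_le hΦ ρ))
    rwa [probReal_univ, mul_one] at h1
  have h1 := abs_le.1 (key ν₁)
  have h2 := abs_le.1 (key ν₂)
  have h3 := abs_le.1 (h k Φ hΦ v hvl hv hvc)
  rw [abs_le]
  constructor <;> linarith [h1.1, h1.2, h2.1, h2.2, h3.1, h3.2]

lemma continuous_integral_continuousMap {K : Type*} [TopologicalSpace K] [CompactSpace K]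
    [MeasurableSpace K] [BorelSpace K] (ν : Measure K) [IsProbabilityMeasure ν] :
    Continuous fun F : C(K, ℝ) => ∫ ρ, F ρ ∂ν := by
  refine (LipschitzWith.of_dist_le_mul (K := 1) fun F G => ?_).continuous
  rw [Real.dist_eq, ← integral_sub (integrable_continuousMap ν F.continuous)
    (integrable_continuousMap ν G.continuous), NNReal.coe_one, one_mul]
  have h1 := norm_integral_le_of_norm_le_const (μ := ν) (C := dist F G)
    (f := fun ρ => F ρ - G ρ) (ae_of_all _ fun ρ => by
      rw [← dist_eq_norm]
      exact ContinuousMap.dist_apply_le_dist ρ)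
  rwa [probReal_univ, mul_one] at h1

end CylBound

section Regularity

open Filter Topology

variable {d : ℕ} {M : ℝ → Measure (Pm d)} [∀ t, IsProbabilityMeasure (M t)]
  {b : ℝ → Ed d → Pm d → Ed d} {a : ℝ → Ed d → Pm d → (Ed d →L[ℝ] Ed d)} {T : ℝ}

variable (M b a T) in
/-- The density controlling the metric speed of the curve. -/
def rate : ℝ → ℝ := (Icc 0 T).indicator fun t => (1 + d) * (wTotal M b a t).toReal

omit [∀ t, IsProbabilityMeasure (M t)] in
lemma rate_nonneg (t : ℝ) : 0 ≤ rate M b a T t :=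
  indicator_nonneg (fun _ _ => by positivity) t

lemma integrable_rate (hb : Measurable fun p : ℝ × Ed d × Pm d => b p.1 p.2.1 p.2.2)
    (ha : Measurable fun p : ℝ × Ed d × Pm d => a p.1 p.2.1 p.2.2)
    (hM : ∀ A : Set (Pm d), MeasurableSet A → Measurable fun t => M t A)
    (hint : ∫⁻ t in Icc 0 T, wTotal M b a t < ∞) : Integrable (rate M b a T) := by
  refine (integrable_indicator_iff measurableSet_Icc).2 (Integrable.const_mul ?_ _)
  exact integrable_toReal_of_lintegral_ne_top (measurable_wTotal hb ha hM).aemeasurable hint.ne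

variable (M b a T) in
/-- The primitive of `rate`. -/
def totalRate (t : ℝ) : ℝ := ∫ r in (0:ℝ)..t, rate M b a T r

lemma abs_integral_sub_le_of_cylinder (hT : 0 < T)
    (hb : Measurable fun p : ℝ × Ed d × Pm d => b p.1 p.2.1 p.2.2)
    (ha : Measurable fun p : ℝ × Ed d × Pm d => a p.1 p.2.1 p.2.2)
    (hM : ∀ A : Set (Pm d), MeasurableSet A → Measurable fun t => M t A)
    (hint : ∫⁻ t in Icc 0 T, wTotal M b a t < ∞)
    {k : ℕ} {Φ : Fin k → Ed d → ℝ} (hΦ : ∀ i, IsUnitTest (Φ i)) {Ψ : (Fin k → ℝ) → ℝ}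
    (hΨ : ContDiff ℝ 1 Ψ) (hΨc : HasCompactSupport Ψ) (hΨl : LipschitzWith 1 Ψ)
    (heq : ∀ ξ, IsTestXi T ξ → ∫ t in (0:ℝ)..T, deriv ξ t * ∫ μ, Ψ (LPhi Φ μ) ∂(M t) =
      - ∫ t in (0:ℝ)..T, ξ t *
        ∫ μ, (∫ x, cylDeriv b a Ψ Φ ((t, μ), x) ∂(μ : Measure (Ed d))) ∂(M t)) :
    ∃ H : ℝ → ℝ, (∀ᵐ t ∂(volume.restrict (Icc 0 T)), ∫ μ, Ψ (LPhi Φ μ) ∂(M t) = H t) ∧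
      ∀ s ∈ Icc 0 T, ∀ t ∈ Icc 0 T,
        |H s - H t| ≤ |totalRate M b a T s - totalRate M b a T t| := by
  have hΦ' : ∀ i, IsTestPhi (Φ i) := fun i => (hΦ i).isTestPhi
  have hbd := abs_cylDeriv_le (b := b) (a := a) hΨl fun i => (hΦ i).weightedBound
  have hR := integrable_rate hb ha hM hint
  obtain ⟨D, hD⟩ := hΨc.exists_bound_of_continuous hΨ.continuous
  have hg := integrableOn_integral_cylinder hM (hΨ.continuous.comp (continuous_LPhi hΦ'))
    (fun μ => hD _) T
  have hh := integrableOn_integral_integral hM hint (measurable_cylDeriv hb ha hΨ hΦ')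
    (by positivity : (0:ℝ) ≤ 1 + d) hbd
  set h : ℝ → ℝ := fun t => ∫ μ, ∫ x, cylDeriv b a Ψ Φ ((t, μ), x) ∂(μ : Measure (Ed d)) ∂(M t)
    with hhdef
  have hg' : IntervalIntegrable (fun t => ∫ μ, Ψ (LPhi Φ μ) ∂(M t)) volume 0 T := by
    rw [intervalIntegrable_iff_integrableOn_Icc_of_le hT.le]
    exact hg
  have hh' : IntervalIntegrable h volume 0 T := by
    rw [intervalIntegrable_iff_integrableOn_Icc_of_le hT.le]
    exact hh
  have hfin : ∀ᵐ t ∂(volume.restrict (Icc 0 T)), wTotal M b a t < ∞ :=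
    ae_lt_top (measurable_wTotal hb ha hM) hint.ne
  have hle : ∀ᵐ t ∂(volume.restrict (Icc 0 T)), |h t| ≤ rate M b a T t := by
    filter_upwards [hfin, ae_restrict_mem measurableSet_Icc] with t ht htI
    rw [rate, indicator_of_mem htI]
    have h1 := enorm_integral_integral_le (M := M) (by positivity : (0:ℝ) ≤ 1 + d) (hbd t)
    rw [Real.enorm_eq_ofReal_abs, ENNReal.ofReal_le_iff_le_toReal
      (ENNReal.mul_lt_top ENNReal.ofReal_lt_top ht).ne, ENNReal.toReal_mul,
      ENNReal.toReal_ofReal (by positivity)] at h1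
    exact h1
  obtain ⟨c, hc⟩ := exists_ae_eq_primitive hT hg' hh' heq
  refine ⟨_, hc, ?_⟩
  have key : ∀ s ∈ Icc 0 T, ∀ t ∈ Icc 0 T, s ≤ t →
      |(c + ∫ r in (0:ℝ)..s, h r) - (c + ∫ r in (0:ℝ)..t, h r)| ≤
        |totalRate M b a T s - totalRate M b a T t| := by
    intro s hs t ht hst
    have hsub : ∀ r ∈ Icc 0 T, IntervalIntegrable h volume 0 r := fun r hr =>
      hh'.mono_set (by
        rw [uIcc_of_le hr.1, uIcc_of_le hT.le]
        exact Icc_subset_Icc_right hr.2)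
    rw [add_sub_add_left_eq_sub, abs_sub_comm, abs_sub_comm (totalRate M b a T s), totalRate,
      totalRate, intervalIntegral.integral_interval_sub_left (hsub t ht) (hsub s hs),
      intervalIntegral.integral_interval_sub_left hR.intervalIntegrable hR.intervalIntegrable]
    refine le_trans ?_ (le_abs_self _)
    refine intervalIntegral.norm_integral_le_of_norm_le (f := h) hst ?_ hR.intervalIntegrable
    rw [ae_restrict_iff' measurableSet_Icc] at hle
    filter_upwards [hle] with r hr hr'
    exact hr ⟨hs.1.trans hr'.1.le, hr'.2.trans ht.2⟩
  intro s hs t ht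
  rcases le_total s t with hst | hst
  · exact key s hs t ht hst
  · rw [abs_sub_comm, abs_sub_comm (totalRate M b a T s)]
    exact key t ht s hs hst

/-- Outside a null set of times the curve is Lipschitz in the dual distance, after
reparametrization by `totalRate`. -/
lemma exists_full_set_cylBound (hT : 0 < T)
    (hb : Measurable fun p : ℝ × Ed d × Pm d => b p.1 p.2.1 p.2.2)
    (ha : Measurable fun p : ℝ × Ed d × Pm d => a p.1 p.2.1 p.2.2)
    (hM : ∀ A : Set (Pm d), MeasurableSet A → Measurable fun t => M t A)
    (hint : ∫⁻ t in Icc 0 T, wTotal M b a t < ∞)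
    (heq : ∀ (k : ℕ) (Ψ : (Fin k → ℝ) → ℝ) (Φ : Fin k → Ed d → ℝ),
      ContDiff ℝ 1 Ψ → HasCompactSupport Ψ → (∀ i, IsTestPhi (Φ i)) →
      ∀ ξ, IsTestXi T ξ → ∫ t in (0:ℝ)..T, deriv ξ t * ∫ μ, Ψ (LPhi Φ μ) ∂(M t) =
      - ∫ t in (0:ℝ)..T, ξ t *
        ∫ μ, (∫ x, cylDeriv b a Ψ Φ ((t, μ), x) ∂(μ : Measure (Ed d))) ∂(M t)) :
    ∃ G ⊆ Icc 0 T, (∀ᵐ t ∂(volume.restrict (Icc 0 T)), t ∈ G) ∧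
      ∀ s ∈ G, ∀ t ∈ G, CylBound ((M s).map toCompactPm) ((M t).map toCompactPm)
        |totalRate M b a T s - totalRate M b a T t| := by
  let S : Set C(CompactPm d, ℝ) := {F | ∃ (k : ℕ) (Φ : Fin k → Ed d → ℝ)
    (hΦ : ∀ i, IsUnitTest (Φ i)) (Ψ : (Fin k → ℝ) → ℝ), LipschitzWith 1 Ψ ∧ ContDiff ℝ 1 Ψ ∧
      HasCompactSupport Ψ ∧ ∀ ρ, F ρ = Ψ (extLPhi Φ (fun i => (hΦ i).isTestPhi) ρ)}
  obtain ⟨S', hS'S, hS'c, hS'd⟩ :=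
    (TopologicalSpace.IsSeparable.of_separableSpace S).exists_countable_dense_subset
  have hS : ∀ F ∈ S', ∃ H : ℝ → ℝ,
      (∀ᵐ t ∂(volume.restrict (Icc 0 T)), ∫ μ, F (toCompactPm μ) ∂(M t) = H t) ∧
      ∀ s ∈ Icc 0 T, ∀ t ∈ Icc 0 T,
        |H s - H t| ≤ |totalRate M b a T s - totalRate M b a T t| := fun F hF => by
    obtain ⟨k, Φ, hΦ, Ψ, hΨl, hΨ, hΨc, hFΨ⟩ := hS'S hF
    simp only [hFΨ, extLPhi_toCompactPm]
    exact abs_integral_sub_le_of_cylinder hT hb ha hM hint hΦ hΨ hΨc hΨl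
      (heq k Ψ Φ hΨ hΨc fun i => (hΦ i).isTestPhi)
  choose! H hH hHl using hS
  refine ⟨{t ∈ Icc 0 T | ∀ F ∈ S', ∫ μ, F (toCompactPm μ) ∂(M t) = H F t}, sep_subset _ _, ?_, ?_⟩
  · filter_upwards [(ae_ball_iff hS'c).2 hH, ae_restrict_mem measurableSet_Icc] with t ht ht'
    exact ⟨ht', ht⟩
  · rintro s ⟨hs, hsS⟩ t ⟨ht, htS⟩
    have hprob : ∀ r, IsProbabilityMeasure ((M r).map (toCompactPm (d := d))) := fun r =>
      Measure.isProbabilityMeasure_map measurableEmbedding_toCompactPm.measurable.aemeasurable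
    refine CylBound.of_contDiff fun k Φ hΦ u hu huc hus => ?_
    let F : C(CompactPm d, ℝ) :=
      ⟨_, huc.continuous.comp (continuous_extLPhi fun i => (hΦ i).isTestPhi)⟩
    have hF : F ∈ closure S' := hS'd ⟨k, Φ, hΦ, u, hu, huc, hus, fun _ => rfl⟩
    have hcl : IsClosed {F : C(CompactPm d, ℝ) |
        |∫ ρ, F ρ ∂((M s).map toCompactPm) - ∫ ρ, F ρ ∂((M t).map toCompactPm)| ≤
          |totalRate M b a T s - totalRate M b a T t|} :=
      isClosed_le ((continuous_integral_continuousMap _).sub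
        (continuous_integral_continuousMap _)).abs continuous_const
    refine closure_minimal (fun F hF => ?_) hcl hF
    rw [mem_ofPred_eq, measurableEmbedding_toCompactPm.integral_map,
      measurableEmbedding_toCompactPm.integral_map, hsS F hF, htS F hF]
    exact hHl F hF s hs t ht

end Regularity

section Limits

open Filter Topology

variable {d : ℕ}

lemma WeightedBound.comp_smul {χ : Ed d → ℝ} (hχ : ContDiff ℝ 2 χ) {C : ℝ}
    (h : WeightedBound χ C) {r : ℝ} (hr : 0 ≤ r) (hr1 : r ≤ 1) :
    WeightedBound (fun x => χ (r • x)) C := by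
  constructor <;> intro x
  · rw [iteratedFDeriv_comp_const_smul r (hχ.of_le (by norm_num)), norm_smul, norm_pow, pow_one,
      Real.norm_of_nonneg hr, ← mul_assoc]
    refine le_trans (mul_le_mul_of_nonneg_right ?_ (norm_nonneg _)) (h.1 (r • x))
    rw [norm_smul, Real.norm_of_nonneg hr]
    linarith
  · rw [iteratedFDeriv_comp_const_smul r hχ, norm_smul, norm_pow, Real.norm_of_nonneg hr,
      ← mul_assoc]
    refine le_trans (mul_le_mul_of_nonneg_right ?_ (norm_nonneg _)) (h.2 (r • x))
    rw [norm_smul, Real.norm_of_nonneg hr, mul_pow]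
    nlinarith [pow_le_one₀ (n := 2) hr hr1]

lemma IsUnitTest.of_weightedBound {χ : Ed d → ℝ} (hχ : IsTestPhi χ) {C c : ℝ}
    (hC : ∀ x, |χ x| ≤ C) (h : WeightedBound χ C) (hc : 0 ≤ c) (hcC : c * C ≤ 1 / 3) :
    IsUnitTest (fun x => c * χ x) := by
  have hd : ∀ n : ℕ, (n : ℕ∞) ≤ 2 → ∀ x,
      ‖iteratedFDeriv ℝ n (fun x => c * χ x) x‖ = c * ‖iteratedFDeriv ℝ n χ x‖ := fun n hn x => by
    change ‖iteratedFDeriv ℝ n (c • χ) x‖ = _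
    rw [iteratedFDeriv_const_smul_apply (hχ.1.of_le (mod_cast hn)).contDiffAt, norm_smul,
      Real.norm_of_nonneg hc]
  refine ⟨contDiff_const.mul hχ.1, hχ.2.mul_left, 1 / 3, 1 / 3, 1 / 3, by norm_num, fun x => ?_,
    fun x => ?_, fun x => ?_⟩
  · rw [abs_mul, abs_of_nonneg hc]
    exact (mul_le_mul_of_nonneg_left (hC x) hc).trans hcC
  · rw [hd 1 (by norm_num), mul_left_comm]
    exact (mul_le_mul_of_nonneg_left (h.1 x) hc).trans hcC
  · rw [hd 2 le_rfl, mul_left_comm]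
    exact (mul_le_mul_of_nonneg_left (h.2 x) hc).trans hcC

/-- Cutoff functions with uniform weighted bounds. -/
lemma exists_cutoff (d : ℕ) : ∃ (χ : ℕ → Ed d → ℝ) (c : ℝ), 0 < c ∧ (∀ n, IsTestPhi (χ n)) ∧
    (∀ n, IsUnitTest fun x => c * χ n x) ∧ (∀ n x, |χ n x| ≤ 1) ∧
      ∀ x, Tendsto (fun n => χ n x) atTop (𝓝 1) := by
  let f : ContDiffBump (0 : Ed d) := ⟨1, 2, one_pos, one_lt_two⟩
  have hf : IsTestPhi (f : Ed d → ℝ) := ⟨f.contDiff, f.hasCompactSupport⟩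
  have hf1 : ∀ x, |f x| ≤ 1 := fun x => abs_le.2 ⟨by linarith [f.nonneg' x], f.le_one⟩
  obtain ⟨C, hC0, hCf, hC⟩ := hf.exists_weightedBound
  have hr : ∀ n : ℕ, (0:ℝ) < ((n : ℝ) + 1)⁻¹ := fun n => by positivity
  have hr1 : ∀ n : ℕ, ((n : ℝ) + 1)⁻¹ ≤ 1 := fun n =>
    inv_le_one_of_one_le₀ (by linarith [n.cast_nonneg (α := ℝ)])
  have hχ : ∀ n : ℕ, IsTestPhi fun x : Ed d => f (((n : ℝ) + 1)⁻¹ • x) := fun n =>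
    ⟨hf.1.comp (contDiff_const_smul _), hf.2.comp_smul (hr n).ne'⟩
  refine ⟨fun n x => f (((n : ℝ) + 1)⁻¹ • x), (3 * (C + 1))⁻¹, by positivity, hχ, fun n => ?_,
    fun n x => hf1 _, fun x => ?_⟩
  · refine IsUnitTest.of_weightedBound (hχ n) (fun x => hCf _)
      (hC.comp_smul hf.1 (hr n).le (hr1 n)) (by positivity) ?_
    rw [inv_mul_le_iff₀ (by positivity)]
    linarith
  · have h1 : Tendsto (fun n : ℕ => ((n : ℝ) + 1)⁻¹ • x) atTop (𝓝 0) := by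
      have := (tendsto_one_div_add_atTop_nhds_zero_nat (𝕜 := ℝ)).smul_const x
      simpa using this
    have h2 := (hf.1.continuous.tendsto 0).comp h1
    rwa [f.eventuallyEq_one.eq_of_nhds] at h2

lemma extendIntegral_const_mul {χ : Ed d → ℝ} (hχ : Continuous χ) (hχc : HasCompactSupport χ)
    (c : ℝ) (h : Continuous fun x => c * χ x) (hc : HasCompactSupport fun x => c * χ x)
    (ρ : CompactPm d) :
    extendIntegral (fun x => c * χ x) h hc ρ = c * extendIntegral χ hχ hχc ρ := by
  change ∫ x, _ ∂_ = c * ∫ x, _ ∂_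
  rw [← integral_const_mul]
  congr 1 with x
  induction x using OnePoint.rec with
  | infty => exact (mul_zero c).symm
  | coe x => rfl

/-- Limits of measures on `P(ℝ^d)` for the dual distance do not charge the boundary of the
compactification. -/
lemma ae_mem_range_of_cylBound (ν : Measure (CompactPm d)) [IsProbabilityMeasure ν]
    (h : ∀ δ > 0, ∃ P : Measure (Pm d), IsProbabilityMeasure P ∧
      CylBound (P.map toCompactPm) ν δ) :
    ∀ᵐ ρ ∂ν, ρ ∈ range (toCompactPm (d := d)) := by
  obtain ⟨χ, c, hc, hχ, hχu, hχ1, hlim⟩ := exists_cutoff d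
  have hχ' : ∀ n, Continuous (χ n) := fun n => (hχ n).1.continuous
  refine ae_mem_range_toCompactPm ν χ hχ' (fun n => (hχ n).2) hχ1 hlim ?_
  have hdiff : ∀ (P : Measure (Pm d)) (δ : ℝ), IsProbabilityMeasure P →
      CylBound (P.map toCompactPm) ν δ → ∀ n,
      c * |∫ μ, ∫ x, χ n x ∂(μ : Measure (Ed d)) ∂P -
        ∫ ρ, extendIntegral (χ n) (hχ' n) (hχ n).2 ρ ∂ν| ≤ δ := fun P δ hP hPδ n => by
    have h1 := hPδ 1 (fun _ x => c * χ n x) (fun _ => hχu n) (fun z => z 0) (LipschitzWith.eval 0)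
    simp only [extLPhi, extendIntegral_const_mul (hχ' n) (hχ n).2] at h1
    rw [integral_const_mul, integral_const_mul, measurableEmbedding_toCompactPm.integral_map,
      ← mul_sub, abs_mul, abs_of_pos hc] at h1
    simpa only [extendIntegral_toCompactPm] using h1
  have hP1 : ∀ (P : Measure (Pm d)), IsProbabilityMeasure P →
      Tendsto (fun n => ∫ μ, ∫ x, χ n x ∂(μ : Measure (Ed d)) ∂P) atTop (𝓝 1) := fun P hP => by
    have hb : ∀ n (μ : Pm d), ‖∫ x, χ n x ∂(μ : Measure (Ed d))‖ ≤ 1 := fun n μ => by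
      have h1 := norm_integral_le_of_norm_le_const (μ := (μ : Measure (Ed d)))
        (f := χ n) (C := 1) (ae_of_all _ (hχ1 n))
      rwa [probReal_univ, mul_one] at h1
    have hm : ∀ n, AEStronglyMeasurable (fun μ : Pm d => ∫ x, χ n x ∂(μ : Measure (Ed d))) P :=
      fun n => ((continuous_apply (0 : Fin 1)).comp
        (continuous_LPhi (Φ := fun _ => χ n) fun _ => hχ n)).aestronglyMeasurable
    have h2 : ∀ μ : Pm d,
        Tendsto (fun n => ∫ x, χ n x ∂(μ : Measure (Ed d))) atTop (𝓝 1) := fun μ => by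
      have := tendsto_integral_of_dominated_convergence (μ := (μ : Measure (Ed d)))
        (f := fun _ => 1) (fun _ => 1)
        (fun n => (hχ' n).aestronglyMeasurable) (integrable_const _)
        (fun n => ae_of_all _ (hχ1 n)) (ae_of_all _ hlim)
      simpa using this
    have := tendsto_integral_of_dominated_convergence (μ := P) (f := fun _ => 1) (fun _ => 1)
      hm (integrable_const _) (fun n => ae_of_all _ (hb n)) (ae_of_all _ h2)
    simpa using this
  rw [Metric.tendsto_atTop]
  intro ε hε
  obtain ⟨P, hP, hPδ⟩ := h (c * (ε / 2)) (by positivity)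
  obtain ⟨N, hN⟩ := Metric.tendsto_atTop.1 (hP1 P hP) (ε / 2) (half_pos hε)
  refine ⟨N, fun n hn => ?_⟩
  have h1 := le_of_mul_le_mul_left (hdiff P _ hP hPδ n) hc
  have h2 := hN n hn
  rw [Real.dist_eq] at h2 ⊢
  rw [abs_lt] at h2 ⊢
  rw [abs_le] at h1
  constructor <;> linarith [h1.1, h1.2, h2.1, h2.2]

lemma exists_map_toCompactPm_eq (ν : Measure (CompactPm d)) [IsProbabilityMeasure ν]
    (h : ∀ᵐ ρ ∂ν, ρ ∈ range (toCompactPm (d := d))) :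
    ∃ P : Measure (Pm d), IsProbabilityMeasure P ∧ P.map toCompactPm = ν := by
  have h1 : (ν.comap toCompactPm).map (toCompactPm (d := d)) = ν := by
    rw [measurableEmbedding_toCompactPm.map_comap, Measure.restrict_eq_self_of_ae_mem h]
  refine ⟨ν.comap toCompactPm, ⟨?_⟩, h1⟩
  rw [← preimage_univ (f := toCompactPm (d := d)), ← measurableEmbedding_toCompactPm.map_apply, h1]
  exact measure_univ

/-- A curve defined on a set of times extends to the closure. -/
lemma exists_cylBound_of_mem_closure {M : ℝ → Measure (Pm d)}
    [∀ t, IsProbabilityMeasure (M t)] {R : ℝ → ℝ} (hR : Continuous R) {G : Set ℝ}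
    (hG : ∀ s ∈ G, ∀ t ∈ G, CylBound ((M s).map toCompactPm) ((M t).map toCompactPm)
      |R s - R t|) {t : ℝ} (ht : t ∈ closure G) :
    ∃ P : Measure (Pm d), IsProbabilityMeasure P ∧
      ∀ s ∈ G, CylBound ((M s).map toCompactPm) (P.map toCompactPm) |R s - R t| := by
  have hprob : ∀ r, IsProbabilityMeasure ((M r).map (toCompactPm (d := d))) := fun r =>
    Measure.isProbabilityMeasure_map measurableEmbedding_toCompactPm.measurable.aemeasurable
  let N : ℝ → ProbabilityMeasure (CompactPm d) := fun r => ⟨(M r).map toCompactPm, hprob r⟩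
  have : (𝓝[G] t).NeBot := mem_closure_iff_nhdsWithin_neBot.1 ht
  let U : Ultrafilter ℝ := Ultrafilter.of (𝓝[G] t)
  have hU : (U : Filter ℝ) ≤ 𝓝[G] t := Ultrafilter.of_le _
  obtain ⟨ν, -, hν⟩ := isCompact_univ.ultrafilter_le_nhds (U.map N) (by simp)
  have hν' : Tendsto N U (𝓝 ν) := hν
  have hbd : ∀ s ∈ G, CylBound ((M s).map toCompactPm) ν |R s - R t| := by
    intro s hs k Φ hΦ u hu
    have hc := hu.continuous.comp (continuous_extLPhi fun i => (hΦ i).isTestPhi)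
    have h1 := ProbabilityMeasure.tendsto_iff_forall_integral_tendsto.1 hν'
      (BoundedContinuousFunction.mkOfCompact ⟨_, hc⟩)
    have h2 : Tendsto (fun r => |R s - R r|) U (𝓝 |R s - R t|) :=
      ((continuous_const.sub hR).abs.tendsto t).mono_left (hU.trans nhdsWithin_le_nhds)
    refine le_of_tendsto_of_tendsto ((tendsto_const_nhds.sub h1).abs) h2 ?_
    filter_upwards [hU self_mem_nhdsWithin] with r hr
    exact hG s hs r hr k Φ hΦ u hu
  obtain ⟨P, hP, hPν⟩ := exists_map_toCompactPm_eq (ν : Measure (CompactPm d))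
    (ae_mem_range_of_cylBound _ fun δ hδ => by
      have h2 : Tendsto (fun r => |R r - R t|) (𝓝[G] t) (𝓝 |R t - R t|) :=
        ((hR.sub continuous_const).abs.tendsto t).mono_left nhdsWithin_le_nhds
      rw [sub_self, abs_zero] at h2
      obtain ⟨s, hs, hsG⟩ := ((h2.eventually_lt_const hδ).and self_mem_nhdsWithin).exists
      exact ⟨M s, inferInstance, fun k Φ hΦ u hu => (hbd s hsG k Φ hΦ u hu).trans hs.le⟩)
  exact ⟨P, hP, by rwa [hPν]⟩

end Limits

section Modification

variable {d : ℕ} {M : ℝ → Measure (Pm d)} [∀ t, IsProbabilityMeasure (M t)]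
  {b : ℝ → Ed d → Pm d → Ed d} {a : ℝ → Ed d → Pm d → (Ed d →L[ℝ] Ed d)} {T : ℝ}

lemma inter_nonempty_of_ae_mem {G o : Set ℝ}
    (hG : ∀ᵐ t ∂(volume.restrict (Icc 0 T)), t ∈ G) (ho : IsOpen o)
    (hne : (o ∩ Ioo 0 T).Nonempty) : (o ∩ G ∩ Ioo 0 T).Nonempty := by
  by_contra hcon
  rw [ae_restrict_iff' measurableSet_Icc] at hG
  refine (((ho.inter isOpen_Ioo).measure_pos volume hne).ne') (measure_mono_null ?_ hG)
  intro t ht htG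
  exact hcon ⟨t, ⟨ht.1, htG (Ioo_subset_Icc_self ht.2)⟩, ht.2⟩

lemma Icc_subset_closure_of_ae_mem (hT : 0 < T) {G : Set ℝ}
    (hG : ∀ᵐ t ∂(volume.restrict (Icc 0 T)), t ∈ G) : Icc 0 T ⊆ closure G := by
  rw [← closure_Ioo hT.ne]
  refine closure_minimal (fun t ht => mem_closure_iff.2 fun o ho hto => ?_) isClosed_closure
  exact (inter_nonempty_of_ae_mem hG ho ⟨t, hto, ht⟩).mono inter_subset_left

/-- The absolutely continuous modification of the curve. -/
lemma exists_cylBound_modification (hT : 0 < T)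
    (hb : Measurable fun p : ℝ × Ed d × Pm d => b p.1 p.2.1 p.2.2)
    (ha : Measurable fun p : ℝ × Ed d × Pm d => a p.1 p.2.1 p.2.2)
    (hM : ∀ A : Set (Pm d), MeasurableSet A → Measurable fun t => M t A)
    (hint : ∫⁻ t in Icc 0 T, wTotal M b a t < ∞)
    (heq : ∀ (k : ℕ) (Ψ : (Fin k → ℝ) → ℝ) (Φ : Fin k → Ed d → ℝ),
      ContDiff ℝ 1 Ψ → HasCompactSupport Ψ → (∀ i, IsTestPhi (Φ i)) →
      ∀ ξ, IsTestXi T ξ → ∫ t in (0:ℝ)..T, deriv ξ t * ∫ μ, Ψ (LPhi Φ μ) ∂(M t) =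
      - ∫ t in (0:ℝ)..T, ξ t *
        ∫ μ, (∫ x, cylDeriv b a Ψ Φ ((t, μ), x) ∂(μ : Measure (Ed d))) ∂(M t)) :
    ∃ M' : ℝ → Measure (Pm d), (∀ t, IsProbabilityMeasure (M' t)) ∧
      (∀ s t, 0 ≤ s → s ≤ t → t ≤ T → CylBound ((M' s).map toCompactPm)
        ((M' t).map toCompactPm) (∫ r in s..t, rate M b a T r)) ∧
      ∀ᵐ t ∂(volume.restrict (Icc 0 T)), M' t = M t := by
  classical
  obtain ⟨G, hGI, hG, hGM⟩ := exists_full_set_cylBound hT hb ha hM hint heq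
  have hR := integrable_rate hb ha hM hint
  have hRc : Continuous (totalRate M b a T) :=
    intervalIntegral.continuous_primitive (fun _ _ => hR.intervalIntegrable) 0
  have hRm : ∀ s t, totalRate M b a T t - totalRate M b a T s = ∫ r in s..t, rate M b a T r :=
    fun s t => intervalIntegral.integral_interval_sub_left hR.intervalIntegrable
      hR.intervalIntegrable
  have hRle : ∀ s t, s ≤ t → |totalRate M b a T s - totalRate M b a T t| =
      ∫ r in s..t, rate M b a T r := fun s t hst => by
    rw [abs_sub_comm, hRm, abs_of_nonneg]
    exact intervalIntegral.integral_nonneg hst fun r _ => rate_nonneg r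
  have hP : ∀ t ∈ Icc 0 T, ∃ P : Measure (Pm d), IsProbabilityMeasure P ∧
      ∀ s ∈ G, CylBound ((M s).map toCompactPm) (P.map toCompactPm)
        |totalRate M b a T s - totalRate M b a T t| := fun t ht =>
    exists_cylBound_of_mem_closure hRc hGM (Icc_subset_closure_of_ae_mem hT hG ht)
  choose! P hPp hPG using hP
  have hM' : ∀ s ∈ G, ∀ t ∈ Icc 0 T, CylBound ((M s).map toCompactPm)
      ((if t ∈ Icc 0 T \ G then P t else M t).map toCompactPm)
        |totalRate M b a T s - totalRate M b a T t| := fun s hs t ht => by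
    split_ifs with h
    · exact hPG t ht s hs
    · exact hGM s hs t (not_not.1 fun h' => h ⟨ht, h'⟩)
  refine ⟨fun t => if t ∈ Icc 0 T \ G then P t else M t, fun t => ?_, fun s t hs hst ht => ?_, ?_⟩
  · dsimp only
    split_ifs with h
    · exact hPp t h.1
    · infer_instance
  · rcases hst.eq_or_lt with rfl | hlt
    · rw [intervalIntegral.integral_same]
      exact CylBound.refl _
    · obtain ⟨m, hsm, hmt⟩ := exists_between hlt
      obtain ⟨r, ⟨hr, hrG⟩, -⟩ := inter_nonempty_of_ae_mem hG isOpen_Ioo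
        ⟨m, ⟨hsm, hmt⟩, hs.trans_lt hsm, hmt.trans_le ht⟩
      have h1 := (hM' r hrG s ⟨hs, hst.trans ht⟩).symm.trans (hM' r hrG t ⟨hs.trans hst, ht⟩)
      rwa [abs_sub_comm, hRle s r hr.1.le, hRle r t hr.2.le,
        intervalIntegral.integral_add_adjacent_intervals hR.intervalIntegrable
          hR.intervalIntegrable] at h1
  · filter_upwards [hG] with t ht
    exact if_neg fun h => h.2 ht

end Modification

section Wasserstein

open Filter Topology

variable {d : ℕ}

lemma D2w_nonneg (μ ν : Measure (Ed d)) : 0 ≤ D2w d μ ν :=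
  Real.sSup_nonneg fun r hr => by
    obtain ⟨φ, -, -, -, rfl⟩ := hr
    exact abs_nonneg _

lemma isUnitTest_zero : IsUnitTest (fun _ : Ed d => (0:ℝ)) := by
  refine ⟨contDiff_const, HasCompactSupport.zero, 0, 0, 0, by norm_num, by simp, fun x => ?_,
    fun x => ?_⟩ <;> simp

/-- A sequence of unit test functions which computes `D2w`. -/
lemma exists_dense_unitTest (d : ℕ) : ∃ (ψ : ℕ → Ed d → ℝ) (hψ : ∀ n, IsUnitTest (ψ n)),
    ∀ (φ : Ed d → ℝ) (hφ : IsUnitTest φ), extendIntegral φ hφ.1.continuous hφ.2.1 ∈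
      closure (range fun n => extendIntegral (ψ n) (hψ n).1.continuous (hψ n).2.1) := by
  let S : Set C(CompactPm d, ℝ) :=
    {F | ∃ (φ : Ed d → ℝ) (h : IsUnitTest φ), F = extendIntegral φ h.1.continuous h.2.1}
  obtain ⟨S', hS'S, hS'c, hS'd⟩ :=
    (TopologicalSpace.IsSeparable.of_separableSpace S).exists_countable_dense_subset
  have hS : S.Nonempty := ⟨_, _, isUnitTest_zero, rfl⟩
  obtain ⟨f, rfl⟩ := hS'c.exists_eq_range (closure_nonempty_iff.1 (hS.mono hS'd))
  choose ψ hψ hf using fun n => hS'S (mem_range_self n)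
  refine ⟨ψ, hψ, fun φ hφ => ?_⟩
  rw [← funext hf]
  exact hS'd ⟨φ, hφ, rfl⟩

lemma tendsto_dist_firstCoords {ψ : ℕ → Ed d → ℝ} (hψ : ∀ n, IsUnitTest (ψ n))
    (hd : ∀ (φ : Ed d → ℝ) (hφ : IsUnitTest φ), extendIntegral φ hφ.1.continuous hφ.2.1 ∈
      closure (range fun n => extendIntegral (ψ n) (hψ n).1.continuous (hψ n).2.1)) (μ ν : Pm d) :
    Tendsto (fun N => dist
      (firstCoords (fun n => extendIntegral (ψ n) (hψ n).1.continuous (hψ n).2.1) N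
        (toCompactPm μ))
      (firstCoords (fun n => extendIntegral (ψ n) (hψ n).1.continuous (hψ n).2.1) N
        (toCompactPm ν))) atTop (𝓝 (D2w d μ ν)) := by
  set f := fun n => extendIntegral (ψ n) (hψ n).1.continuous (hψ n).2.1 with hf
  have hbdd : BddAbove {r | ∃ φ : Ed d → ℝ, ContDiff ℝ 2 φ ∧ HasCompactSupport φ ∧
      (∃ A B C : ℝ, A + B + C ≤ 1 ∧ (∀ x, |φ x| ≤ A) ∧
        (∀ x, (1 + ‖x‖) * ‖iteratedFDeriv ℝ 1 φ x‖ ≤ B) ∧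
        (∀ x, (1 + ‖x‖ ^ 2) * ‖iteratedFDeriv ℝ 2 φ x‖ ≤ C)) ∧
      r = |∫ x, φ x ∂(μ : Measure (Ed d)) - ∫ x, φ x ∂(ν : Measure (Ed d))|} := by
    refine ⟨2, ?_⟩
    rintro r ⟨φ, h1, h2, h3, rfl⟩
    have hφ : IsUnitTest φ := ⟨h1, h2, h3⟩
    rw [← extendIntegral_toCompactPm φ h1.continuous h2,
      ← extendIntegral_toCompactPm φ h1.continuous h2]
    have h4 := abs_le.1 (abs_extendIntegral_le h1.continuous h2 hφ.abs_le_one (toCompactPm μ))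
    have h5 := abs_le.1 (abs_extendIntegral_le h1.continuous h2 hφ.abs_le_one (toCompactPm ν))
    rw [abs_le]
    constructor <;> linarith [h4.1, h4.2, h5.1, h5.2]
  refine tendsto_atTop_isLUB (fun m n hmn => ?_) ⟨?_, fun L hL => ?_⟩
  · exact (dist_pi_le_iff dist_nonneg).2 fun i =>
      dist_le_pi_dist (firstCoords f n (toCompactPm μ)) (firstCoords f n (toCompactPm ν))
        (Fin.castLE hmn i)
  · rintro _ ⟨N, rfl⟩
    refine (dist_pi_le_iff (D2w_nonneg _ _)).2 fun i => ?_
    refine le_csSup hbdd ⟨ψ i, (hψ i).1, (hψ i).2.1, (hψ i).2.2, ?_⟩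
    rw [Real.dist_eq, ← extendIntegral_toCompactPm (ψ i) (hψ i).1.continuous (hψ i).2.1,
      ← extendIntegral_toCompactPm (ψ i) (hψ i).1.continuous (hψ i).2.1]
    rfl
  · have hcl : IsClosed {F : C(CompactPm d, ℝ) | dist (F (toCompactPm μ)) (F (toCompactPm ν)) ≤ L} :=
      isClosed_le ((continuous_eval_const _).dist (continuous_eval_const _)) continuous_const
    have hsub : range f ⊆
        {F : C(CompactPm d, ℝ) | dist (F (toCompactPm μ)) (F (toCompactPm ν)) ≤ L} := by
      rintro _ ⟨n, rfl⟩
      exact (dist_le_pi_dist (firstCoords f (n + 1) (toCompactPm μ))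
        (firstCoords f (n + 1) (toCompactPm ν)) (Fin.last n)).trans (hL ⟨n + 1, rfl⟩)
    refine csSup_le ⟨_, _, isUnitTest_zero.1, isUnitTest_zero.2.1, isUnitTest_zero.2.2, rfl⟩ ?_
    rintro r ⟨φ, h1, h2, h3, rfl⟩
    have h4 := closure_minimal hsub hcl (hd φ ⟨h1, h2, h3⟩)
    rwa [mem_ofPred_eq, Real.dist_eq, extendIntegral_toCompactPm, extendIntegral_toCompactPm] at h4

/-- A coupling on the compactification with marginals living on `P(ℝ^d)` comes from a coupling on
`P(ℝ^d)`. -/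
lemma exists_coupling_of_coupling_map {P Q : Measure (Pm d)}
    {π : Measure (CompactPm d × CompactPm d)} [IsProbabilityMeasure π]
    (hP : π.map Prod.fst = P.map toCompactPm) (hQ : π.map Prod.snd = Q.map toCompactPm) :
    ∃ pl : Measure (Pm d × Pm d), IsProbabilityMeasure pl ∧ pl.map Prod.fst = P ∧
      pl.map Prod.snd = Q ∧ pl.map (Prod.map toCompactPm toCompactPm) = π := by
  have hj := measurableEmbedding_toCompactPm (d := d)
  have hjj := hj.prodMap hj
  have hr : ∀ P : Measure (Pm d), ∀ᵐ ρ ∂(P.map toCompactPm), ρ ∈ range (toCompactPm (d := d)) :=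
    fun P => hj.ae_map_iff.2 (ae_of_all _ mem_range_self)
  have h1 : ∀ᵐ p ∂π, p.1 ∈ range (toCompactPm (d := d)) :=
    ae_of_ae_map measurable_fst.aemeasurable (hP ▸ hr P)
  have h2 : ∀ᵐ p ∂π, p.2 ∈ range (toCompactPm (d := d)) :=
    ae_of_ae_map measurable_snd.aemeasurable (hQ ▸ hr Q)
  have hπ : (π.comap (Prod.map toCompactPm toCompactPm)).map
      (Prod.map (toCompactPm (d := d)) (toCompactPm (d := d))) = π := by
    rw [hjj.map_comap, Measure.restrict_eq_self_of_ae_mem]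
    filter_upwards [h1, h2] with p hp1 hp2
    rw [range_prodMap]
    exact ⟨hp1, hp2⟩
  have hinj : ∀ {P Q : Measure (Pm d)}, P.map toCompactPm = Q.map toCompactPm → P = Q :=
    fun {P Q} h => by rw [← hj.comap_map P, h, hj.comap_map]
  refine ⟨π.comap (Prod.map toCompactPm toCompactPm), ⟨?_⟩, hinj ?_, hinj ?_, hπ⟩
  · rw [← preimage_univ (f := Prod.map (toCompactPm (d := d)) (toCompactPm (d := d))),
      ← hjj.map_apply, hπ]
    exact measure_univ
  · rw [← hP, Measure.map_map hj.measurable measurable_fst]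
    conv_rhs => rw [← hπ, Measure.map_map measurable_fst hjj.measurable]
    rfl
  · rw [← hQ, Measure.map_map hj.measurable measurable_snd]
    conv_rhs => rw [← hπ, Measure.map_map measurable_snd hjj.measurable]
    rfl

/-- Kantorovich duality for `WD2w`. -/
theorem WD2w_le_of_cylBound {P Q : Measure (Pm d)} [IsProbabilityMeasure P]
    [IsProbabilityMeasure Q] {V : ℝ}
    (h : CylBound (P.map toCompactPm) (Q.map toCompactPm) V) : WD2w d P Q ≤ V := by
  have hprob : ∀ (P : Measure (Pm d)) [IsProbabilityMeasure P],
      IsProbabilityMeasure (P.map (toCompactPm (d := d))) := fun P _ =>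
    Measure.isProbabilityMeasure_map measurableEmbedding_toCompactPm.measurable.aemeasurable
  have hPp := hprob P
  have hQp := hprob Q
  obtain ⟨ψ, hψ, hd⟩ := exists_dense_unitTest d
  set f := fun n => extendIntegral (ψ n) (hψ n).1.continuous (hψ n).2.1 with hf
  obtain ⟨π, hπ, hπP, hπQ, hπV⟩ := exists_coupling_of_lipschitz_bound (P.map toCompactPm)
    (Q.map toCompactPm) f fun N u hu =>
      (le_abs_self _).trans (h N (fun i => ψ i) (fun i => hψ i) u hu)
  obtain ⟨pl, hpl, hplP, hplQ, hplπ⟩ := exists_coupling_of_coupling_map hπP hπQ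
  have hcont : ∀ N, Continuous fun p : CompactPm d × CompactPm d =>
      dist (firstCoords f N p.1) (firstCoords f N p.2) := fun N =>
    ((continuous_firstCoords f N).comp continuous_fst).dist
      ((continuous_firstCoords f N).comp continuous_snd)
  have hjj := (measurableEmbedding_toCompactPm (d := d)).prodMap
    (measurableEmbedding_toCompactPm (d := d))
  have hnorm : ∀ N ρ, ‖firstCoords f N ρ‖ ≤ 1 := fun N ρ =>
    norm_extLPhi_le (fun i : Fin N => hψ i) ρ
  have hlim := tendsto_integral_of_dominated_convergence (μ := pl) (fun _ => 2)
    (fun N => ((hcont N).measurable.comp hjj.measurable).aestronglyMeasurable)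
    (integrable_const _) (fun N => ae_of_all _ fun p => by
      rw [Function.comp_apply, Real.norm_of_nonneg dist_nonneg]
      refine (dist_le_norm_add_norm _ _).trans ?_
      exact (add_le_add (hnorm N _) (hnorm N _)).trans_eq one_add_one_eq_two)
    (ae_of_all _ fun p => tendsto_dist_firstCoords hψ hd p.1 p.2)
  have hle : WD2w d P Q ≤ ∫ p, D2w d (p.1 : Measure (Ed d)) (p.2 : Measure (Ed d)) ∂pl :=
    csInf_le ⟨0, by
      rintro r ⟨pl, -, -, -, rfl⟩
      exact integral_nonneg fun p => D2w_nonneg _ _⟩ ⟨pl, hpl, hplP, hplQ, rfl⟩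
  refine hle.trans (le_of_tendsto' hlim fun N => ?_)
  refine le_trans (le_of_eq ?_) (hπV N)
  rw [← hplπ, hjj.integral_map]
  rfl

end Wasserstein

/-- If `(M_t)` is a Borel measurable curve of random measures with
the weighted integrability solving `∂_t M_t = K^*_{b_t,a_t} M_t` weakly, then for every
cylinder function `F = Ψ∘L_Φ`, `t ↦ ∫ F dM_t` belongs to `W^{1,1}(0,T)` with the stated
distributional derivative, and `M` has an a.e. representative that is absolutely
continuous for the Wasserstein distance `W_{1,D_{2,w}}` on `P(P(ℝ^d))`. -/
theorem stmt19 {T : ℝ} {d : ℕ} (hT : 0 ≤ T)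
    (b : ℝ → Ed d → Pm d → Ed d)
    (a : ℝ → Ed d → Pm d → (Ed d →L[ℝ] Ed d))
    (hb : Measurable fun p : ℝ × Ed d × Pm d => b p.1 p.2.1 p.2.2)
    (ha : Measurable fun p : ℝ × Ed d × Pm d => a p.1 p.2.1 p.2.2)
    (M : ℝ → Measure (Pm d)) (hMp : ∀ t, IsProbabilityMeasure (M t))
    (hMmeas : ∀ A : Set (Pm d), MeasurableSet A → Measurable fun t => M t A)
    (hMint : (∫⁻ t in Set.Icc (0:ℝ) T, ∫⁻ μ, ∫⁻ x,
        ENNReal.ofReal (wInt b a t x μ) ∂(μ : Measure (Ed d)) ∂(M t) ∂volume) < ∞)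
    (hMeq : ∀ (k : ℕ) (Ψ : (Fin k → ℝ) → ℝ) (Φ : Fin k → Ed d → ℝ),
      ContDiff ℝ 1 Ψ → HasCompactSupport Ψ → (∀ i, IsTestPhi (Φ i)) →
      ∀ ξ, IsTestXi T ξ →
      ∫ t in (0:ℝ)..T, deriv ξ t * ∫ μ, Ψ (LPhi Φ μ) ∂(M t) =
        - ∫ t in (0:ℝ)..T, ξ t *
            ∫ μ, (∫ x, (∑ i, fderiv ℝ Ψ (LPhi Φ μ) (Pi.single i 1) *
                Lop b a μ t (Φ i) x) ∂(μ : Measure (Ed d))) ∂(M t)) :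
    (∀ (k : ℕ) (Ψ : (Fin k → ℝ) → ℝ) (Φ : Fin k → Ed d → ℝ),
      ContDiff ℝ 1 Ψ → HasCompactSupport Ψ → (∀ i, IsTestPhi (Φ i)) →
      IntegrableOn (fun t => ∫ μ, Ψ (LPhi Φ μ) ∂(M t)) (Set.Icc 0 T) ∧
      IntegrableOn (fun t => ∫ μ, (∑ i, fderiv ℝ Ψ (LPhi Φ μ) (Pi.single i 1) *
          ∫ x, Lop b a μ t (Φ i) x ∂(μ : Measure (Ed d))) ∂(M t)) (Set.Icc 0 T) ∧
      (∀ ξ, IsTestXi T ξ →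
        ∫ t in (0:ℝ)..T, deriv ξ t * ∫ μ, Ψ (LPhi Φ μ) ∂(M t) =
          - ∫ t in (0:ℝ)..T, ξ t *
              ∫ μ, (∑ i, fderiv ℝ Ψ (LPhi Φ μ) (Pi.single i 1) *
                ∫ x, Lop b a μ t (Φ i) x ∂(μ : Measure (Ed d))) ∂(M t))) ∧
    (∃ M' : ℝ → Measure (Pm d),
      (∀ t, IsProbabilityMeasure (M' t)) ∧
      (∃ m : ℝ → ℝ, IntegrableOn m (Set.Icc 0 T) ∧
        ∀ t₁ t₂ : ℝ, 0 ≤ t₁ → t₁ ≤ t₂ → t₂ ≤ T →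
          WD2w d (M' t₁) (M' t₂) ≤ ∫ r in t₁..t₂, m r) ∧
      (∀ᵐ t ∂(volume.restrict (Set.Icc (0:ℝ) T)), M' t = M t)) := by
  have hint : ∫⁻ t in Icc 0 T, wTotal M b a t < ∞ := hMint
  have hfin : ∀ᵐ t ∂(volume.restrict (Icc 0 T)), wTotal M b a t < ∞ :=
    ae_lt_top (measurable_wTotal hb ha hMmeas) hint.ne
  refine ⟨fun k Ψ Φ hΨ hΨc hΦ => ?_, ?_⟩
  · obtain ⟨D, hD⟩ := hΨc.exists_bound_of_continuous hΨ.continuous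
    obtain ⟨C, hC, hCb⟩ := exists_abs_cylDeriv_le (b := b) (a := a) hΨ hΨc hΦ
    have hae : (fun t => ∫ μ, ∫ x, cylDeriv b a Ψ Φ ((t, μ), x) ∂(μ : Measure (Ed d)) ∂(M t))
        =ᵐ[volume.restrict (Icc 0 T)] fun t => ∫ μ, (∑ i, fderiv ℝ Ψ (LPhi Φ μ) (Pi.single i 1) *
          ∫ x, Lop b a μ t (Φ i) x ∂(μ : Measure (Ed d))) ∂(M t) := by
      filter_upwards [hfin] with t ht using integral_cylDeriv_eq hb ha Ψ hΦ ht
    refine ⟨integrableOn_integral_cylinder hMmeas (hΨ.continuous.comp (continuous_LPhi hΦ))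
      (fun μ => hD _) T, (integrableOn_integral_integral hMmeas hint
        (measurable_cylDeriv hb ha hΨ hΦ) hC hCb).congr hae, fun ξ hξ => ?_⟩
    rw [hMeq k Ψ Φ hΨ hΨc hΦ ξ hξ]
    congr 1
    refine intervalIntegral.integral_congr_ae_restrict ?_
    rw [uIoc_of_le hT]
    filter_upwards [ae_restrict_of_ae_restrict_of_subset Ioc_subset_Icc_self hae] with t ht
    exact congrArg (ξ t * ·) ht
  · rcases hT.eq_or_lt with rfl | hT'
    · refine ⟨M, hMp, ⟨0, integrableOn_zero, fun t₁ t₂ h₁ h₁₂ h₂ => ?_⟩, ae_of_all _ fun _ => rfl⟩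
      obtain rfl : t₁ = t₂ := le_antisymm h₁₂ (h₂.trans h₁)
      rw [intervalIntegral.integral_same]
      exact WD2w_le_of_cylBound (CylBound.refl _)
    · obtain ⟨M', hM'p, hM'b, hM'ae⟩ :=
        exists_cylBound_modification hT' hb ha hMmeas hint hMeq
      exact ⟨M', hM'p, ⟨rate M b a T, (integrable_rate hb ha hMmeas hint).integrableOn,
        fun t₁ t₂ h₁ h₁₂ h₂ => WD2w_le_of_cylBound (hM'b t₁ t₂ h₁ h₁₂ h₂)⟩, hM'ae⟩
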